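/- arXiv:1503.08458 — 5 statements merged into one kernel-verified Lean document; each statement's English description precedes it below -/
import Mathlib

section
/- A closed generating convex cone K ⊆ ℝ^m is an isotonic projection cone (i.e., for all x, y ∈ ℝ^m, x ≤_K y implies P_K x ≤_K P_K y) if and only if its dual cone K* is a simplicial cone in the subspace it spans generated by vectors with mutually non-acute angles; that is, K* = cone{u_1, …, u_p} for some linearly independent vectors u_1, …, u_p with ⟨u_i, u_j⟩ ≤ 0 for all i ≠ j. -/
open scoped RealInnerProductSpace

section ProjectionCones

open ProperCone

variable {E ι : Type*} [NormedAddCommGroup E] [InnerProductSpace ℝ E]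

/-- For mutually non-acute vectors, the positive and negative parts of a linear combination
form a non-acute angle. -/
lemma inner_sum_posPart_sum_negPart_nonpos {u : ι → E} (hu : ∀ i j, i ≠ j → ⟪u i, u j⟫ ≤ 0)
    (s : Finset ι) (w : ι → ℝ) :
    ⟪∑ i ∈ s, (w i)⁺ • u i, ∑ i ∈ s, (w i)⁻ • u i⟫ ≤ 0 := by
  rw [sum_inner]
  refine Finset.sum_nonpos fun i _ => ?_
  rw [inner_sum]
  refine Finset.sum_nonpos fun j _ => ?_
  rw [real_inner_smul_left, real_inner_smul_right]
  rcases eq_or_ne i j with rfl | hij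
  · have : (w i)⁺ * (w i)⁻ = 0 := by
      rcases le_total 0 (w i) with h | h
      · simp [negPart_eq_zero.2 h]
      · simp [posPart_eq_zero.2 h]
    rw [← mul_assoc, this, zero_mul]
  · exact mul_nonpos_of_nonneg_of_nonpos (posPart_nonneg _)
      (mul_nonpos_of_nonneg_of_nonpos (negPart_nonneg _) (hu i j hij))

/-- Mutually non-acute vectors lying in an open half-space are linearly independent. -/
lemma linearIndependent_of_inner_nonpos {u : ι → E} (hu : ∀ i j, i ≠ j → ⟪u i, u j⟫ ≤ 0)
    {b : E} (hb : ∀ i, 0 < ⟪b, u i⟫) : LinearIndependent ℝ u := by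
  have key : ∀ (s : Finset ι) (w : ι → ℝ), ∑ i ∈ s, w i • u i = 0 → ∀ i ∈ s, (w i)⁺ = 0 := by
    intro s w hw
    have heq : ∑ i ∈ s, (w i)⁺ • u i = ∑ i ∈ s, (w i)⁻ • u i := by
      rw [← sub_eq_zero, ← Finset.sum_sub_distrib, ← hw]
      exact Finset.sum_congr rfl fun i _ => by rw [← sub_smul, posPart_sub_negPart]
    have hle := inner_sum_posPart_sum_negPart_nonpos hu s w
    rw [← heq] at hle
    have h0 := congrArg (fun x => ⟪b, x⟫) (real_inner_self_nonpos.1 hle)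
    simp only [inner_sum, real_inner_smul_right, inner_zero_right] at h0
    rw [Finset.sum_eq_zero_iff_of_nonneg
      fun i _ => mul_nonneg (posPart_nonneg _) (hb i).le] at h0
    exact fun i hi => (mul_eq_zero.1 (h0 i hi)).resolve_right (hb i).ne'
  rw [linearIndependent_iff']
  intro s w hw i hi
  have h1 := key s w hw i hi
  have h2 := key s (-w) (by simp [hw]) i hi
  rw [posPart_eq_zero] at h1 h2
  simp only [Pi.neg_apply] at h2
  linarith

/-- The cone generated by finitely many linearly independent vectors is a proper cone. -/
lemma LinearIndependent.exists_properCone [Fintype ι] {u : ι → E} (hu : LinearIndependent ℝ u) :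
    ∃ D : ProperCone ℝ E, ∀ y, y ∈ D ↔ ∃ t : ι → ℝ, (∀ i, 0 ≤ t i) ∧ y = ∑ i, t i • u i := by
  have hclosed : IsClosed {y | ∃ t : ι → ℝ, (∀ i, 0 ≤ t i) ∧ y = ∑ i, t i • u i} := by
    have hinj : (Fintype.linearCombination ℝ u).ker = ⊥ :=
      LinearMap.ker_eq_bot.2 (linearIndependent_iff_injective_fintypeLinearCombination.1 hu)
    convert (LinearMap.isClosedEmbedding_of_injective hinj).isClosedMap _ (isClosed_Ici (a := 0))
      using 1
    ext y
    simp [Pi.le_def, Fintype.linearCombination_apply, eq_comm]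
  refine ⟨{ carrier := _, isClosed' := hclosed, add_mem' := ?_, zero_mem' := ?_, smul_mem' := ?_ },
    fun y => Iff.rfl⟩
  · rintro _ _ ⟨s, hs, rfl⟩ ⟨t, ht, rfl⟩
    exact ⟨s + t, fun i => add_nonneg (hs i) (ht i), by
      simp [add_smul, Finset.sum_add_distrib]⟩
  · exact ⟨0, fun _ => le_rfl, by simp⟩
  · rintro c _ ⟨t, ht, rfl⟩
    exact ⟨fun i => c * t i, fun i => mul_nonneg c.2 (ht i), by
      simp [Finset.smul_sum, mul_smul]⟩

variable {K : ProperCone ℝ E} {P : E → E}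

lemma ProperCone.real_smul_mem {t : ℝ} (ht : 0 ≤ t) {x : E} (hx : x ∈ K) : t • x ∈ K :=
  K.smul_mem hx ht

variable [CompleteSpace E]

/-- One half of Moreau's decomposition: `P x - x` lies in the dual cone and is orthogonal
to `P x`. -/
lemma ProperCone.moreau_of_dist_le (hP : ∀ x, P x ∈ K ∧ ∀ q ∈ K, dist x (P x) ≤ dist x q) (x : E) :
    P x - x ∈ innerDual (K : Set E) ∧ ⟪P x, P x - x⟫ = 0 := by
  have hmin : ‖x - P x‖ = ⨅ w : (K : Set E), ‖x - w‖ := by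
    refine le_antisymm ?_ (ciInf_le ⟨0, ?_⟩ (⟨P x, (hP x).1⟩ : (K : Set E)))
    · have : Nonempty (K : Set E) := ⟨⟨P x, (hP x).1⟩⟩
      exact le_ciInf fun w => by simpa [dist_eq_norm] using (hP x).2 w w.2
    · rintro _ ⟨w, rfl⟩
      exact norm_nonneg _
  have hconv : Convex ℝ (K : Set E) := fun a ha c hc s t hs ht _ =>
    K.add_mem (real_smul_mem hs ha) (real_smul_mem ht hc)
  have hvar := (norm_eq_iInf_iff_real_inner_le_zero hconv (hP x).1).1 hmin
  have hswap : ∀ w, ⟪w, P x - x⟫ = -⟪x - P x, w⟫ := fun w => by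
    rw [real_inner_comm, ← inner_neg_left, neg_sub]
  refine ⟨fun w hw => ?_, ?_⟩
  · change 0 ≤ ⟪w, P x - x⟫
    have := hvar (P x + w) (K.add_mem (hP x).1 hw)
    rw [add_sub_cancel_left] at this
    rw [hswap]
    linarith
  · have h0 := hvar 0 K.zero_mem
    have h2 := hvar (P x + P x) (K.add_mem (hP x).1 (hP x).1)
    rw [add_sub_cancel_left] at h2
    rw [zero_sub, inner_neg_right] at h0
    rw [hswap]
    linarith

/-- The converse half of Moreau's decomposition, which determines the projection. -/
lemma ProperCone.proj_eq_of_moreau (hP : ∀ x, P x ∈ K ∧ ∀ q ∈ K, dist x (P x) ≤ dist x q)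
    {x a : E} (ha : a ∈ K) (hax : a - x ∈ innerDual (K : Set E)) (horth : ⟪a, a - x⟫ = 0) :
    P x = a := by
  obtain ⟨hmem, horth'⟩ := moreau_of_dist_le hP x
  have h1 : 0 ≤ ⟪P x, a - x⟫ := hax (hP x).1
  have h2 : 0 ≤ ⟪a, P x - x⟫ := hmem ha
  have h3 : ⟪P x - a, P x - a⟫ ≤ 0 := by
    have : ⟪P x - a, P x - a⟫ = ⟪P x, P x - x⟫ - ⟪P x, a - x⟫ - ⟪a, P x - x⟫ + ⟪a, a - x⟫ := by
      simp only [inner_sub_left, inner_sub_right]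
      ring
    linarith
  exact sub_eq_zero.1 (real_inner_self_nonpos.1 h3)

/-- If the dual cone is generated by linearly independent, mutually non-acute vectors, then the
projection onto the cone is isotone. -/
lemma ProperCone.isotone_proj_of_inner_nonpos [Fintype ι]
    (hP : ∀ x, P x ∈ K ∧ ∀ q ∈ K, dist x (P x) ≤ dist x q)
    {u : ι → E} (hli : LinearIndependent ℝ u) (hu : ∀ i j, i ≠ j → ⟪u i, u j⟫ ≤ 0)
    (hdual : ∀ y, y ∈ innerDual (K : Set E) ↔
      ∃ t : ι → ℝ, (∀ i, 0 ≤ t i) ∧ y = ∑ i, t i • u i)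
    {x y : E} (hxy : y - x ∈ K) : P y - P x ∈ K := by
  classical
  have hu_mem : ∀ i, u i ∈ innerDual (K : Set E) := fun i =>
    (hdual _).2 ⟨Pi.single i 1, fun j => by by_cases h : j = i <;> simp [h],
      by simp [Pi.single_apply]⟩
  have hK : ∀ z, (∀ i, 0 ≤ ⟪z, u i⟫) → z ∈ K := by
    intro z hz
    rw [← innerDual_innerDual K]
    intro c hc
    obtain ⟨t, ht, rfl⟩ := (hdual c).1 hc
    change 0 ≤ ⟪∑ i, t i • u i, z⟫
    rw [sum_inner]
    refine Finset.sum_nonneg fun i _ => ?_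
    rw [real_inner_smul_left, real_inner_comm]
    exact mul_nonneg (ht i) (hz i)
  have hdecomp : ∀ x, ∃ t : ι → ℝ, (∀ i, 0 ≤ t i) ∧ P x = x + ∑ i, t i • u i ∧
      ∀ i, t i ≠ 0 → ⟪P x, u i⟫ = 0 := by
    intro x
    obtain ⟨hmem, horth⟩ := moreau_of_dist_le hP x
    obtain ⟨t, ht, hPx⟩ := (hdual _).1 hmem
    refine ⟨t, ht, by rw [← hPx]; abel, fun i hi => ?_⟩
    rw [hPx, inner_sum, Finset.sum_eq_zero_iff_of_nonneg] at horth
    · have := horth i (Finset.mem_univ i)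
      rw [real_inner_smul_right] at this
      exact (mul_eq_zero.1 this).resolve_left hi
    · intro j _
      rw [real_inner_smul_right]
      exact mul_nonneg (ht j) (hu_mem j (hP x).1)
  obtain ⟨s, hs, hPx, hsx⟩ := hdecomp x
  obtain ⟨t, ht, hPy, hty⟩ := hdecomp y
  have hnn : ∀ z ∈ K, ∀ i, 0 ≤ ⟪z, u i⟫ := fun z hz i => hu_mem i hz
  have hdiff : P y - P x = (y - x) + ∑ i, (t i - s i) • u i := by
    rw [hPx, hPy]
    simp only [sub_smul, Finset.sum_sub_distrib]
    abel
  have hts : ∀ i, t i ≤ s i := by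
    set w : ι → ℝ := fun i => t i - s i with hw
    have hcoord : ∀ i, (w i)⁺ * ⟪∑ j, w j • u j, u i⟫ ≤ 0 := by
      intro i
      rcases le_or_gt (w i) 0 with h | h
      · simp [posPart_eq_zero.2 h]
      · refine mul_nonpos_of_nonneg_of_nonpos (posPart_nonneg _) ?_
        have hti : t i ≠ 0 := by
          have := hs i
          simp only [hw] at h
          linarith
        have h1 := congrArg (fun z => ⟪z, u i⟫) hdiff
        simp only [inner_add_left] at h1
        rw [inner_sub_left, hty i hti] at h1
        have := hnn _ (hP x).1 i
        have := hnn _ hxy i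
        linarith
    have hsum : ⟪∑ j, w j • u j, ∑ i, (w i)⁺ • u i⟫ ≤ 0 := by
      rw [inner_sum]
      exact Finset.sum_nonpos fun i _ => by rw [real_inner_smul_right]; exact hcoord i
    have hsplit : ∑ j, w j • u j = ∑ j, (w j)⁺ • u j - ∑ j, (w j)⁻ • u j := by
      rw [← Finset.sum_sub_distrib]
      exact Finset.sum_congr rfl fun i _ => by rw [← sub_smul, posPart_sub_negPart]
    have hneg := inner_sum_posPart_sum_negPart_nonpos hu Finset.univ w
    rw [hsplit, inner_sub_left, real_inner_comm _ (∑ j, (w j)⁻ • u j)] at hsum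
    have hzero : ∑ i, (w i)⁺ • u i = 0 := real_inner_self_nonpos.1 (by linarith)
    intro i
    have := Fintype.linearIndependent_iff.1 hli _ hzero i
    rw [posPart_eq_zero] at this
    simp only [hw] at this
    linarith
  refine hK _ fun i => ?_
  by_cases hsi : s i = 0
  · have hti : t i = 0 := le_antisymm (hsi ▸ hts i) (ht i)
    rw [hdiff, inner_add_left, sum_inner]
    refine add_nonneg (hnn _ hxy i) (Finset.sum_nonneg fun j _ => ?_)
    rw [real_inner_smul_left]
    rcases eq_or_ne j i with rfl | hji
    · simp [hsi, hti]
    · exact mul_nonneg_of_nonpos_of_nonpos (sub_nonpos.2 (hts j)) (hu j i hji)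
  · rw [inner_sub_left, hsx i hsi, sub_zero]
    exact hnn _ (hP y).1 i

/-- The generators of the exposed rays of the dual cone of `K`, normalized by `⟪b, e⟫ = 1`. -/
def ProperCone.exposedGenerators (K : ProperCone ℝ E) (b : E) : Set E :=
  {e | e ∈ innerDual (K : Set E) ∧ ⟪b, e⟫ = 1 ∧ ∃ a ∈ K, ⟪a, e⟫ = 0 ∧
    ∀ c ∈ innerDual (K : Set E), ⟪a, c⟫ = 0 → c = ⟪b, c⟫ • e}

/-- If the projection onto `K` is isotone, then the orthogonal projection along an exposed ray of
the dual cone maps `K` into itself. -/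
lemma ProperCone.sub_smul_exposed_mem (hP : ∀ x, P x ∈ K ∧ ∀ q ∈ K, dist x (P x) ≤ dist x q)
    (hiso : ∀ x y, y - x ∈ K → P y - P x ∈ K) {b u : E} (hu : u ∈ K.exposedGenerators b)
    {h : E} (hh : h ∈ K) : h - (⟪h, u⟫ / ⟪u, u⟫) • u ∈ K := by
  obtain ⟨hud, hbu, a, ha, hau, hexp⟩ := hu
  have hu0 : u ≠ 0 := by
    rintro rfl
    simp at hbu
  have huu : 0 < ⟪u, u⟫ := real_inner_self_pos.2 hu0
  have hhu : 0 ≤ ⟪h, u⟫ := hud hh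
  set t : ℝ := ⟪h, u⟫ / ⟪u, u⟫ + 1 with ht
  have ht0 : 0 ≤ t := by positivity
  have htu : t * ⟪u, u⟫ = ⟪h, u⟫ + ⟪u, u⟫ := by
    rw [ht]
    field_simp
  have hPx : P (a - t • u) = a := by
    refine proj_eq_of_moreau hP ha ?_ ?_
    · rw [sub_sub_cancel]
      exact real_smul_mem ht0 hud
    · rw [sub_sub_cancel, real_inner_smul_right, hau, mul_zero]
  have hstep := hiso (a - t • u) (a - t • u + h) (by rwa [add_sub_cancel_left])
  rw [hPx] at hstep
  set y := a - t • u + h with hy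
  obtain ⟨hcmem, horth⟩ := moreau_of_dist_le hP y
  have hac : ⟪a, P y - y⟫ = 0 := by
    refine le_antisymm ?_ (hcmem ha)
    have : 0 ≤ ⟪P y - a, P y - y⟫ := hcmem hstep
    rw [inner_sub_left] at this
    linarith
  have hc := hexp _ hcmem hac
  set s : ℝ := ⟪b, P y - y⟫
  have hPy : P y - a = h - (t - s) • u := by
    rw [sub_smul, sub_eq_iff_eq_add.1 hc, hy]
    abel
  have hPyu : ⟪P y, u⟫ = ⟪h, u⟫ - (t - s) * ⟪u, u⟫ := by
    have := congrArg (fun z => ⟪z, u⟫) hPy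
    simpa [inner_sub_left, real_inner_smul_left, hau] using this
  have hs : s ≠ 0 := by
    intro hs0
    have : 0 ≤ ⟪P y, u⟫ := hud (hP y).1
    rw [hs0, sub_zero] at hPyu
    linarith
  have hPy0 : ⟪P y, u⟫ = 0 := by
    rw [hc, real_inner_smul_right] at horth
    exact (mul_eq_zero.1 horth).resolve_left hs
  have hcoef : ⟪h, u⟫ / ⟪u, u⟫ = t - s := by
    rw [div_eq_iff huu.ne']
    linarith
  rw [hcoef, ← hPy]
  exact hstep

/-- If the projection onto `K` is isotone, then distinct exposed rays of the dual cone form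
non-acute angles. -/
lemma ProperCone.inner_exposed_nonpos (hP : ∀ x, P x ∈ K ∧ ∀ q ∈ K, dist x (P x) ≤ dist x q)
    (hiso : ∀ x y, y - x ∈ K → P y - P x ∈ K) {b u v : E} (hu : u ∈ K.exposedGenerators b)
    (hv : v ∈ K.exposedGenerators b) (huv : u ≠ v) : ⟪u, v⟫ ≤ 0 := by
  by_contra! hpos
  obtain ⟨hvd, hbv, a, ha, hav, hexp⟩ := hv
  have huu : 0 < ⟪u, u⟫ := real_inner_self_pos.2 fun h0 => by simp [h0] at hpos
  have h1 : 0 ≤ ⟪a - (⟪a, u⟫ / ⟪u, u⟫) • u, v⟫ := hvd (sub_smul_exposed_mem hP hiso hu ha)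
  rw [inner_sub_left, real_inner_smul_left, hav, zero_sub] at h1
  have hau : 0 ≤ ⟪a, u⟫ := hu.1 ha
  have hau0 : ⟪a, u⟫ = 0 := by
    by_contra hne
    have : 0 < ⟪a, u⟫ / ⟪u, u⟫ * ⟪u, v⟫ :=
      mul_pos (div_pos (lt_of_le_of_ne hau (Ne.symm hne)) huu) hpos
    linarith
  exact huv (by simpa [hu.2.1] using hexp u hu.1 hau0)

/-- If a proper cone is generating, some linear functional dominates the norm on its dual cone. -/
lemma ProperCone.exists_norm_le_inner [FiniteDimensional ℝ E]
    (hgen : ∀ z : E, ∃ x ∈ K, ∃ y ∈ K, z = x - y) :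
    ∃ b, ∀ c ∈ innerDual (K : Set E), ‖c‖ ≤ ⟪b, c⟫ := by
  set e := stdOrthonormalBasis ℝ E
  choose p hp q hq hpq using fun i => hgen (e i)
  refine ⟨∑ i, (p i + q i), fun c hc => ?_⟩
  calc ‖c‖ = ‖∑ i, ⟪e i, c⟫ • e i‖ := by rw [e.sum_repr' c]
    _ ≤ ∑ i, ‖⟪e i, c⟫ • e i‖ := norm_sum_le _ _
    _ ≤ ∑ i, ⟪p i + q i, c⟫ := Finset.sum_le_sum fun i _ => by
        have h1 : 0 ≤ ⟪p i, c⟫ := hc (hp i)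
        have h2 : 0 ≤ ⟪q i, c⟫ := hc (hq i)
        rw [norm_smul, e.orthonormal.1 i, mul_one, Real.norm_eq_abs, hpq i, inner_sub_left,
          inner_add_left, abs_le]
        constructor <;> linarith
    _ = ⟪∑ i, (p i + q i), c⟫ := (sum_inner _ _ _).symm

/-- A point of the base `⟪b, ·⟫ = 1` of the dual cone at maximal distance from some point is an
exposed generator. -/
lemma ProperCone.mem_exposedGenerators_of_dist_le {b : E}
    (hb : ∀ c ∈ innerDual (K : Set E), ‖c‖ ≤ ⟪b, c⟫) {e q : E}
    (he : e ∈ innerDual (K : Set E)) (hbe : ⟪b, e⟫ = 1)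
    (hmax : ∀ c ∈ innerDual (K : Set E), ⟪b, c⟫ = 1 → ‖c - q‖ ≤ ‖e - q‖) :
    e ∈ K.exposedGenerators b := by
  set a : E := ⟪e - q, e⟫ • b - (e - q) with ha
  have hbase : ∀ c ∈ innerDual (K : Set E), ⟪b, c⟫ = 1 → ‖e - c‖ ^ 2 ≤ 2 * ⟪a, c⟫ := by
    intro c hc hbc
    have hac : ⟪a, c⟫ = ⟪e - q, e - c⟫ := by
      rw [ha, inner_sub_left, real_inner_smul_left, hbc, inner_sub_right]
      ring
    have h1 : ‖c - q‖ ^ 2 = ‖e - q‖ ^ 2 - 2 * ⟪e - q, e - c⟫ + ‖e - c‖ ^ 2 := by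
      rw [← norm_sub_sq_real, sub_sub_sub_cancel_left]
    have h2 : ‖c - q‖ ^ 2 ≤ ‖e - q‖ ^ 2 := by
      gcongr
      exact hmax c hc hbc
    rw [hac]
    linarith
  have hscale : ∀ c ∈ innerDual (K : Set E),
      c = 0 ∨ 0 < ⟪b, c⟫ ∧ ‖e - ⟪b, c⟫⁻¹ • c‖ ^ 2 ≤ 2 * (⟪b, c⟫⁻¹ * ⟪a, c⟫) := by
    intro c hc
    rcases eq_or_ne c 0 with h0 | h0
    · exact .inl h0
    · have hpos : 0 < ⟪b, c⟫ := (norm_pos_iff.2 h0).trans_le (hb c hc)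
      have := hbase (⟪b, c⟫⁻¹ • c) (real_smul_mem (inv_nonneg.2 hpos.le) hc)
        (by rw [real_inner_smul_right, inv_mul_cancel₀ hpos.ne'])
      rw [real_inner_smul_right] at this
      exact .inr ⟨hpos, this⟩
  refine ⟨he, hbe, a, ?_, ?_, fun c hc hac => ?_⟩
  · rw [← innerDual_innerDual K]
    intro c hc
    change 0 ≤ ⟪c, a⟫
    rw [real_inner_comm]
    rcases hscale c hc with rfl | ⟨hpos, hle⟩
    · simp
    · have : 0 ≤ ⟪b, c⟫⁻¹ * ⟪a, c⟫ := by linarith [sq_nonneg ‖e - ⟪b, c⟫⁻¹ • c‖]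
      exact nonneg_of_mul_nonneg_right this (inv_pos.2 hpos)
  · rw [ha, inner_sub_left, real_inner_smul_left, hbe, mul_one, sub_self]
  · rcases hscale c hc with rfl | ⟨hpos, hle⟩
    · simp
    · rw [hac, mul_zero, mul_zero] at hle
      have h0 : e - ⟪b, c⟫⁻¹ • c = 0 := by
        rw [← norm_eq_zero]
        exact pow_eq_zero_iff two_ne_zero |>.1 (le_antisymm hle (sq_nonneg _))
      rw [sub_eq_zero.1 h0, smul_inv_smul₀ hpos.ne']

/-- The exposed generators detect every open half-space which meets the dual cone. -/
lemma ProperCone.exists_exposed_inner_pos [FiniteDimensional ℝ E] {b : E}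
    (hb : ∀ c ∈ innerDual (K : Set E), ‖c‖ ≤ ⟪b, c⟫) {v f : E}
    (hv : v ∈ innerDual (K : Set E)) (hfv : 0 < ⟪f, v⟫) :
    ∃ e ∈ K.exposedGenerators b, 0 < ⟪f, e⟫ := by
  set B : Set E := {c | c ∈ innerDual (K : Set E) ∧ ⟪b, c⟫ = 1}
  have hBclosed : IsClosed B :=
    (innerDual (K : Set E)).isClosed.inter
      (isClosed_eq (continuous_const.inner continuous_id) continuous_const)
  have hBcomp : IsCompact B := by
    refine (isCompact_closedBall (0 : E) 1).of_isClosed_subset hBclosed fun c hc => ?_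
    rw [mem_closedBall_zero_iff, ← hc.2]
    exact hb c hc.1
  have hv0 : v ≠ 0 := by
    rintro rfl
    simp at hfv
  have hbv : 0 < ⟪b, v⟫ := (norm_pos_iff.2 hv0).trans_le (hb v hv)
  set w : E := ⟪b, v⟫⁻¹ • v with hw
  have hwB : w ∈ B := ⟨real_smul_mem (inv_nonneg.2 hbv.le) hv, by
    rw [hw, real_inner_smul_right, inv_mul_cancel₀ hbv.ne']⟩
  have hfw : 0 < ⟪f, w⟫ := by
    rw [hw, real_inner_smul_right]
    exact mul_pos (inv_pos.2 hbv) hfv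
  set N : ℝ := ⟪f, w⟫⁻¹
  have hN : 0 < N := inv_pos.2 hfw
  have hNw : N * ⟪f, w⟫ = 1 := inv_mul_cancel₀ hfw.ne'
  obtain ⟨e, heB, hmax⟩ := hBcomp.exists_isMaxOn ⟨w, hwB⟩
    (f := fun c => ‖c - (-N) • f‖) (by fun_prop)
  refine ⟨e, mem_exposedGenerators_of_dist_le hb heB.1 heB.2
    fun c hc hbc => hmax ⟨hc, hbc⟩, ?_⟩
  have hexpand : ∀ c : E, ‖c - (-N) • f‖ ^ 2 = ‖c‖ ^ 2 + 2 * (N * ⟪f, c⟫) + ‖N • f‖ ^ 2 := by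
    intro c
    rw [neg_smul, sub_neg_eq_add, norm_add_sq_real, real_inner_smul_right, real_inner_comm]
  have hle : ‖w - (-N) • f‖ ^ 2 ≤ ‖e - (-N) • f‖ ^ 2 := by
    gcongr
    exact hmax hwB
  rw [hexpand, hexpand, hNw] at hle
  have he1 : ‖e‖ ^ 2 ≤ 1 := pow_le_one₀ (norm_nonneg _) (heB.2 ▸ hb e heB.1)
  have : 0 < N * ⟪f, e⟫ := by nlinarith [sq_nonneg ‖w‖]
  exact pos_of_mul_pos_right this hN.le

/-- If the projection onto a generating proper cone is isotone, then its dual cone is generated by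
linearly independent, mutually non-acute vectors. -/
lemma ProperCone.exists_generators_of_isotone_proj [FiniteDimensional ℝ E]
    (hgen : ∀ z : E, ∃ x ∈ K, ∃ y ∈ K, z = x - y)
    (hP : ∀ x, P x ∈ K ∧ ∀ q ∈ K, dist x (P x) ≤ dist x q)
    (hiso : ∀ x y, y - x ∈ K → P y - P x ∈ K) :
    ∃ (p : ℕ) (u : Fin p → E), LinearIndependent ℝ u ∧ (∀ i j, i ≠ j → ⟪u i, u j⟫ ≤ 0) ∧
      ∀ y, y ∈ innerDual (K : Set E) ↔
        ∃ t : Fin p → ℝ, (∀ i, 0 ≤ t i) ∧ y = ∑ i, t i • u i := by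
  classical
  obtain ⟨b, hb⟩ := exists_norm_le_inner hgen
  have hobt : ∀ i j : K.exposedGenerators b, i ≠ j → ⟪(i : E), j⟫ ≤ 0 := fun i j hij =>
    inner_exposed_nonpos hP hiso i.2 j.2 (Subtype.coe_injective.ne hij)
  have hli : LinearIndependent ℝ (Subtype.val : K.exposedGenerators b → E) :=
    linearIndependent_of_inner_nonpos hobt (b := b) fun i => by simp [i.2.2.1]
  have : Finite (K.exposedGenerators b) := hli.finite
  obtain ⟨p, ⟨σ⟩⟩ := Finite.exists_equiv_fin (K.exposedGenerators b)
  set u : Fin p → E := fun i => σ.symm i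
  have hliu : LinearIndependent ℝ u := hli.comp _ σ.symm.injective
  refine ⟨p, u, hliu, fun i j hij => hobt _ _ (σ.symm.injective.ne hij), fun y => ⟨?_, ?_⟩⟩
  · intro hy
    obtain ⟨D, hD⟩ := hliu.exists_properCone
    rw [← hD]
    by_contra hyD
    obtain ⟨f, hf, hfy⟩ := D.hyperplane_separation' hyD
    obtain ⟨e, he, hfe⟩ := exists_exposed_inner_pos hb (f := -f) hy
      (by rw [inner_neg_left, real_inner_comm]; linarith)
    have heD : e ∈ D := (hD e).2 ⟨Pi.single (σ ⟨e, he⟩) 1,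
      fun j => by by_cases h : j = σ ⟨e, he⟩ <;> simp [h],
      by simp [u, Pi.single_apply]⟩
    have := hf e heD
    rw [inner_neg_left, real_inner_comm] at hfe
    linarith
  · rintro ⟨t, ht, rfl⟩
    exact (innerDual (K : Set E)).sum_mem fun i _ => real_smul_mem (ht i) (σ.symm i).2.1

end ProjectionCones

/-- A closed generating convex cone `K ⊆ ℝ^m` is an isotonic projection
cone (i.e. `x ≤_K y` implies `P_K x ≤_K P_K y`, where `P_K` is the metric projection onto
`K`) if and only if its dual cone `K*` is a simplicial cone in the subspace it spans,
generated by linearly independent vectors with mutually non-acute angles. -/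
theorem stmt_0 {m : ℕ} (K : Set (EuclideanSpace ℝ (Fin m)))
    (hclosed : IsClosed K)
    (hadd : ∀ x ∈ K, ∀ y ∈ K, x + y ∈ K)
    (hsmul : ∀ t : ℝ, 0 ≤ t → ∀ x ∈ K, t • x ∈ K)
    (hgen : ∀ z : EuclideanSpace ℝ (Fin m), ∃ x ∈ K, ∃ y ∈ K, z = x - y)
    (P : EuclideanSpace ℝ (Fin m) → EuclideanSpace ℝ (Fin m))
    (hP : ∀ x, P x ∈ K ∧ ∀ q ∈ K, dist x (P x) ≤ dist x q) :
    (∀ x y : EuclideanSpace ℝ (Fin m), y - x ∈ K → P y - P x ∈ K) ↔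
      ∃ (p : ℕ) (u : Fin p → EuclideanSpace ℝ (Fin m)),
        LinearIndependent ℝ u ∧
        (∀ i j, i ≠ j → ⟪u i, u j⟫ ≤ 0) ∧
        {y | ∀ x ∈ K, 0 ≤ ⟪x, y⟫} =
          {y | ∃ t : Fin p → ℝ, (∀ i, 0 ≤ t i) ∧ y = ∑ i, t i • u i} := by
  obtain ⟨x₀, hx₀, -⟩ := hgen 0
  let C : ProperCone ℝ (EuclideanSpace ℝ (Fin m)) :=
    { carrier := K
      isClosed' := hclosed
      add_mem' := fun {x y} hx hy => hadd x hx y hy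
      zero_mem' := by simpa using hsmul 0 le_rfl x₀ hx₀
      smul_mem' := fun c x hx => hsmul c c.2 x hx }
  constructor
  · intro hiso
    obtain ⟨p, u, hli, hu, hdual⟩ :=
      ProperCone.exists_generators_of_isotone_proj (K := C) hgen hP hiso
    exact ⟨p, u, hli, hu, Set.ext hdual⟩
  · rintro ⟨p, u, hli, hu, hdual⟩ x y hxy
    exact ProperCone.isotone_proj_of_inner_nonpos (K := C) hP hli hu (Set.ext_iff.1 hdual) hxy
end

section
/- Let m ≥ 2. For each pair k < l in {1,…,m}, let a_{kl1} ∈ ℝ^m be the vector with k-th coordinate −2, l-th coordinate 1, and all other coordinates 0, and let a_{kl2} ∈ ℝ^m be the vector with k-th coordinate 1, l-th coordinate −2, and all other coordinates 0. Then K = ∩_{k<l} (H_-(a_{kl1}, 0) ∩ H_-(a_{kl2}, 0)) is a generating convex cone contained in ℝ^m_+, is an ℝ^m_+-isotonic projection set, the vector (1,1,…,1) is an interior point of K, and K possesses exactly m(m−1) facets. -/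
open scoped RealInnerProductSpace

/-- `F` is a facet of the cone `K ⊆ ℝ^m`: `F` is the intersection of `K` with a supporting
hyperplane through the origin, and `F` is `(m-1)`-dimensional. -/
def IsFacet {m : ℕ} (K F : Set (EuclideanSpace ℝ (Fin m))) : Prop :=
  ∃ a : EuclideanSpace ℝ (Fin m), a ≠ 0 ∧ (∀ x ∈ K, ⟪a, x⟫ ≤ 0) ∧
    F = {x ∈ K | ⟪a, x⟫ = 0} ∧
    Module.finrank ℝ (Submodule.span ℝ F) = m - 1

/-- The vector of `ℝ^m` whose `k`-th coordinate is `c`, `l`-th coordinate is `d` (for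
`k ≠ l`) and all other coordinates are `0`. -/
noncomputable def twoCoordVec {m : ℕ} (k l : Fin m) (c d : ℝ) : EuclideanSpace ℝ (Fin m) :=
  c • EuclideanSpace.single k (1 : ℝ) + d • EuclideanSpace.single l (1 : ℝ)

/-- The solution set of the strict inequalities `x l < 2 * x k` for `(k, l) ∈ S`. -/
def strictRatioSet {m : ℕ} (S : Set (Fin m × Fin m)) : Set (EuclideanSpace ℝ (Fin m)) :=
  {x | ∀ p ∈ S, x p.2 < 2 * x p.1}

/-- The cone of vectors whose coordinates differ pairwise by a factor of at most two. -/
def ratioCone (m : ℕ) : Set (EuclideanSpace ℝ (Fin m)) :=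
  {x | ∀ k l : Fin m, k ≠ l → x l ≤ 2 * x k}

/-- The face of the ratio cone on which the inequality indexed by `p` is an equality. -/
def ratioFace {m : ℕ} (p : Fin m × Fin m) : Set (EuclideanSpace ℝ (Fin m)) :=
  {x ∈ ratioCone m | x p.2 = 2 * x p.1}

/-- A vector at which only the inequality indexed by `p` is an equality. -/
noncomputable def ratioFacePoint {m : ℕ} (p : Fin m × Fin m) : EuclideanSpace ℝ (Fin m) :=
  WithLp.toLp 2 fun i => if i = p.1 then 1 else if i = p.2 then 2 else 3 / 2

theorem inner_twoCoordVec {m : ℕ} (k l : Fin m) (c d : ℝ) (x : EuclideanSpace ℝ (Fin m)) :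
    ⟪twoCoordVec k l c d, x⟫ = c * x k + d * x l := by
  simp [twoCoordVec, inner_add_left, inner_smul_left, EuclideanSpace.inner_single_left]

theorem twoCoordVec_ne_zero {m : ℕ} {k l : Fin m} (h : k ≠ l) :
    twoCoordVec k l (-2) 1 ≠ 0 := by
  intro h0
  have := congrArg (fun v : EuclideanSpace ℝ (Fin m) => v k) h0
  simp [twoCoordVec, h] at this

theorem isOpen_strictRatioSet {m : ℕ} (S : Set (Fin m × Fin m)) :
    IsOpen (strictRatioSet S) := by
  have : strictRatioSet S =
      ⋂ p ∈ S, {x : EuclideanSpace ℝ (Fin m) | x p.2 < 2 * x p.1} := by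
    ext x; simp [strictRatioSet]
  rw [this]
  refine S.toFinite.isOpen_biInter fun p _ => isOpen_lt ?_ ?_ <;> fun_prop

theorem IsOpen.exists_pos_add_smul_mem {E : Type*} [NormedAddCommGroup E] [NormedSpace ℝ E]
    {U : Set E} (hU : IsOpen U) {p : E} (hp : p ∈ U) (v : E) :
    ∃ ε : ℝ, 0 < ε ∧ p + ε • v ∈ U := by
  have hc : Continuous fun ε : ℝ => p + ε • v := by fun_prop
  have h : ∀ᶠ ε in nhds (0 : ℝ), p + ε • v ∈ U :=
    hc.continuousAt.eventually_mem (hU.mem_nhds (by simpa using hp))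
  have h' := (h.filter_mono (nhdsWithin_le_nhds (s := Set.Ioi 0))).and self_mem_nhdsWithin
  obtain ⟨ε, h1, h2⟩ := h'.exists
  exact ⟨ε, h2, h1⟩

theorem strictRatioSet_offDiag_subset {m : ℕ} :
    strictRatioSet {p : Fin m × Fin m | p.1 ≠ p.2} ⊆ ratioCone m :=
  fun _ hx k l hkl => (hx (k, l) hkl).le

theorem ratioFacePoint_mem_strictRatioSet {m : ℕ} {p : Fin m × Fin m} (hp : p.1 ≠ p.2) :
    ratioFacePoint p ∈ strictRatioSet {q | q.1 ≠ q.2 ∧ q ≠ p} := by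
  rintro ⟨i, j⟩ ⟨hij, hq⟩
  obtain ⟨k, l⟩ := p
  simp only [ne_eq, Prod.mk.injEq, not_and] at hij hq hp
  simp only [ratioFacePoint]
  split_ifs <;> first | exact absurd ‹j = l› (hq ‹i = k›) | norm_num

theorem ratioFacePoint_eq {m : ℕ} {p : Fin m × Fin m} (hp : p.1 ≠ p.2) :
    ratioFacePoint p p.2 = 2 * ratioFacePoint p p.1 := by
  simp [ratioFacePoint, hp.symm]

theorem mem_ratioFace_of_strict {m : ℕ} {p : Fin m × Fin m} {x : EuclideanSpace ℝ (Fin m)}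
    (hx : x ∈ strictRatioSet {q | q.1 ≠ q.2 ∧ q ≠ p}) (he : x p.2 = 2 * x p.1) :
    x ∈ ratioFace p := by
  refine ⟨fun k l hkl => ?_, he⟩
  by_cases h : (k, l) = p
  · subst h; exact he.le
  · exact (hx (k, l) ⟨hkl, h⟩).le

theorem ratioFacePoint_mem {m : ℕ} {p : Fin m × Fin m} (hp : p.1 ≠ p.2) :
    ratioFacePoint p ∈ ratioFace p :=
  mem_ratioFace_of_strict (ratioFacePoint_mem_strictRatioSet hp) (ratioFacePoint_eq hp)

theorem ratioFace_injOn {m : ℕ} :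
    Set.InjOn (ratioFace (m := m)) {p | p.1 ≠ p.2} := by
  intro p hp q hq h
  by_contra hne
  have h1 : ratioFacePoint p ∈ ratioFace q := h ▸ ratioFacePoint_mem hp
  exact (ratioFacePoint_mem_strictRatioSet hp q ⟨hq, Ne.symm hne⟩).ne h1.2

theorem finrank_span_singleton_orthogonal {m : ℕ} {a : EuclideanSpace ℝ (Fin m)} (ha : a ≠ 0) :
    Module.finrank ℝ (ℝ ∙ a)ᗮ = m - 1 := by
  have h := (ℝ ∙ a).finrank_add_finrank_orthogonal
  rw [finrank_span_singleton ha, finrank_euclideanSpace_fin] at h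
  omega

theorem span_ratioFace {m : ℕ} {p : Fin m × Fin m} (hp : p.1 ≠ p.2) :
    Submodule.span ℝ (ratioFace p) = (ℝ ∙ twoCoordVec p.1 p.2 (-2) 1)ᗮ := by
  apply le_antisymm
  · rw [Submodule.span_le]
    intro x hx
    rw [SetLike.mem_coe, Submodule.mem_orthogonal_singleton_iff_inner_right, inner_twoCoordVec,
      hx.2]
    ring
  · intro v hv
    rw [Submodule.mem_orthogonal_singleton_iff_inner_right, inner_twoCoordVec] at hv
    obtain ⟨ε, hε, hm⟩ := (isOpen_strictRatioSet _).exists_pos_add_smul_mem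
      (ratioFacePoint_mem_strictRatioSet hp) v
    have hF : ratioFacePoint p + ε • v ∈ ratioFace p := by
      refine mem_ratioFace_of_strict hm ?_
      have := ratioFacePoint_eq hp
      simp only [PiLp.add_apply, PiLp.smul_apply, smul_eq_mul]
      linear_combination this + ε * hv
    have hd := Submodule.sub_mem _ (Submodule.subset_span (R := ℝ) hF)
      (Submodule.subset_span (ratioFacePoint_mem hp))
    rw [add_sub_cancel_left] at hd
    exact (Submodule.smul_mem_iff _ hε.ne').1 hd

theorem isFacet_ratioFace {m : ℕ} {p : Fin m × Fin m} (hp : p.1 ≠ p.2) :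
    IsFacet (ratioCone m) (ratioFace p) := by
  refine ⟨twoCoordVec p.1 p.2 (-2) 1, twoCoordVec_ne_zero hp, fun x hx => ?_, ?_, ?_⟩
  · have := hx _ _ hp
    rw [inner_twoCoordVec]
    linarith
  · ext x
    simp only [ratioFace, Set.mem_ofPred_eq, inner_twoCoordVec]
    refine and_congr_right fun _ => ⟨fun h => ?_, fun h => ?_⟩ <;> linarith
  · rw [span_ratioFace hp, finrank_span_singleton_orthogonal (twoCoordVec_ne_zero hp)]

theorem IsFacet.exists_subset_ratioFace {m : ℕ} {F : Set (EuclideanSpace ℝ (Fin m))}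
    (hF : IsFacet (ratioCone m) F) : ∃ p : Fin m × Fin m, p.1 ≠ p.2 ∧ F ⊆ ratioFace p := by
  obtain ⟨a, ha, hle, rfl, -⟩ := hF
  by_contra! hcon
  have hpt : ∀ p : Fin m × Fin m, ∃ x ∈ ratioCone m, ⟪a, x⟫ = 0 ∧
      (p.1 ≠ p.2 → x p.2 < 2 * x p.1) := by
    intro p
    by_cases hp : p.1 = p.2
    · exact ⟨0, fun k l _ => by simp, by simp, fun h => absurd hp h⟩
    · obtain ⟨x, ⟨hx, hxa⟩, hxp⟩ := Set.not_subset.1 (hcon p hp)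
      exact ⟨x, hx, hxa, fun _ => lt_of_le_of_ne (hx _ _ hp) fun h => hxp ⟨hx, h⟩⟩
  choose f hfK hfa hfs using hpt
  have hs : ∑ p, f p ∈ strictRatioSet {p : Fin m × Fin m | p.1 ≠ p.2} := by
    intro q hq
    simp only [WithLp.ofLp_sum, Finset.sum_apply, Finset.mul_sum]
    exact Finset.sum_lt_sum (fun p _ => hfK p _ _ hq) ⟨q, Finset.mem_univ _, hfs q hq⟩
  obtain ⟨ε, hε, hmem⟩ := (isOpen_strictRatioSet _).exists_pos_add_smul_mem hs a
  have h := hle _ (strictRatioSet_offDiag_subset hmem)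
  rw [inner_add_right, inner_sum, Finset.sum_eq_zero fun p _ => hfa p, inner_smul_right,
    zero_add] at h
  exact absurd h (not_le.2 (mul_pos hε (real_inner_self_pos.2 ha)))

theorem IsFacet.exists_eq_ratioFace {m : ℕ} {F : Set (EuclideanSpace ℝ (Fin m))}
    (hF : IsFacet (ratioCone m) F) : ∃ p : Fin m × Fin m, p.1 ≠ p.2 ∧ ratioFace p = F := by
  obtain ⟨p, hp, hsub⟩ := hF.exists_subset_ratioFace
  obtain ⟨a, ha, -, hFa, hdim⟩ := hF
  refine ⟨p, hp, subset_antisymm (fun x hx => ?_) hsub⟩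
  have hspan : Submodule.span ℝ F = Submodule.span ℝ (ratioFace p) := by
    refine Submodule.eq_of_le_of_finrank_eq (Submodule.span_mono hsub) ?_
    rw [hdim, span_ratioFace hp, finrank_span_singleton_orthogonal (twoCoordVec_ne_zero hp)]
  have hle : Submodule.span ℝ F ≤ (ℝ ∙ a)ᗮ := by
    rw [Submodule.span_le, hFa]
    exact fun y hy => Submodule.mem_orthogonal_singleton_iff_inner_right.2 hy.2
  have hxa := hle (hspan ▸ Submodule.subset_span hx)
  rw [hFa]
  exact ⟨hx.1, Submodule.mem_orthogonal_singleton_iff_inner_right.1 hxa⟩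

theorem setOf_isFacet_ratioCone (m : ℕ) :
    {F | IsFacet (ratioCone m) F} =
      ratioFace '' ((Finset.univ : Finset (Fin m)).offDiag : Set (Fin m × Fin m)) := by
  ext F
  simp only [Set.mem_ofPred_eq, Set.mem_image, Finset.mem_coe, Finset.mem_offDiag,
    Finset.mem_univ, true_and]
  constructor
  · exact IsFacet.exists_eq_ratioFace
  · rintro ⟨p, hp, rfl⟩
    exact isFacet_ratioFace hp

theorem ncard_isFacet_ratioCone (m : ℕ) :
    {F | IsFacet (ratioCone m) F}.ncard = m * (m - 1) := by
  rw [setOf_isFacet_ratioCone, Set.InjOn.ncard_image, Set.ncard_coe_finset,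
    Finset.offDiag_card, Finset.card_univ, Fintype.card_fin, Nat.mul_sub_one]
  exact ratioFace_injOn.mono fun p hp => (Finset.mem_offDiag.1 hp).2.2

/-- The metric projection onto a convex set closed under coordinatewise minima and maxima is
monotone in the coordinatewise order. -/
theorem proj_isotone_of_lattice {ι : Type*} [Fintype ι] {K : Set (EuclideanSpace ℝ ι)}
    (hconv : Convex ℝ K)
    (hinf : ∀ u ∈ K, ∀ v ∈ K, WithLp.toLp 2 (fun i => min (u i) (v i)) ∈ K)
    (hsup : ∀ u ∈ K, ∀ v ∈ K, WithLp.toLp 2 (fun i => max (u i) (v i)) ∈ K)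
    {x y u v : EuclideanSpace ℝ ι} (hu : u ∈ K) (hv : v ∈ K)
    (hxu : ∀ q ∈ K, dist x u ≤ dist x q) (hyv : ∀ q ∈ K, dist y v ≤ dist y q)
    (hxy : ∀ i, x i ≤ y i) (i : ι) : u i ≤ v i := by
  have key : ∀ z w : EuclideanSpace ℝ ι, dist z w ^ 2 = ∑ i, (z i - w i) ^ 2 := fun z w => by
    simp [EuclideanSpace.dist_eq, Real.dist_eq, Real.sq_sqrt, Finset.sum_nonneg, sq_nonneg]
  have h1 := hxu _ (hconv hu (hinf u hu v hv) (a := 1 / 2) (b := 1 / 2)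
    (by norm_num) (by norm_num) (by norm_num))
  have h2 := hyv _ (hconv hv (hsup u hu v hv) (a := 1 / 2) (b := 1 / 2)
    (by norm_num) (by norm_num) (by norm_num))
  have h1' := pow_le_pow_left₀ dist_nonneg h1 2
  have h2' := pow_le_pow_left₀ dist_nonneg h2 2
  rw [key, key] at h1' h2'
  simp only [PiLp.add_apply, PiLp.smul_apply, smul_eq_mul] at h1' h2'
  by_contra! hi
  have hlt := Finset.sum_lt_sum (s := Finset.univ)
    (f := fun j => (x j - (1 / 2 * u j + 1 / 2 * min (u j) (v j))) ^ 2 +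
      (y j - (1 / 2 * v j + 1 / 2 * max (u j) (v j))) ^ 2)
    (g := fun j => (x j - u j) ^ 2 + (y j - v j) ^ 2)
    (fun j _ => by
      have := hxy j
      rcases le_total (u j) (v j) with h | h
      · rw [min_eq_left h, max_eq_right h]
        exact le_of_eq (by ring)
      · rw [min_eq_right h, max_eq_left h]
        nlinarith [mul_nonneg (sub_nonneg.2 h) (sub_nonneg.2 this), sq_nonneg (u j - v j)])
    ⟨i, Finset.mem_univ _, by
      rw [min_eq_right hi.le, max_eq_left hi.le]
      nlinarith [mul_nonneg (sub_nonneg.2 hi.le) (sub_nonneg.2 (hxy i)),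
        pow_pos (sub_pos.2 hi) 2]⟩
  simp only [Finset.sum_add_distrib] at hlt
  linarith

theorem add_mem_ratioCone {m : ℕ} {x y : EuclideanSpace ℝ (Fin m)} (hx : x ∈ ratioCone m)
    (hy : y ∈ ratioCone m) : x + y ∈ ratioCone m := by
  intro k l h
  have := hx k l h
  have := hy k l h
  simp only [PiLp.add_apply]
  linarith

theorem smul_mem_ratioCone {m : ℕ} {t : ℝ} (ht : 0 ≤ t) {x : EuclideanSpace ℝ (Fin m)}
    (hx : x ∈ ratioCone m) : t • x ∈ ratioCone m := by
  intro k l h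
  have := mul_le_mul_of_nonneg_left (hx k l h) ht
  simp only [PiLp.smul_apply, smul_eq_mul]
  linarith

theorem convex_ratioCone (m : ℕ) : Convex ℝ (ratioCone m) :=
  fun _ hx _ hy _ _ ha hb _ =>
    add_mem_ratioCone (smul_mem_ratioCone ha hx) (smul_mem_ratioCone hb hy)

theorem inf_mem_ratioCone {m : ℕ} {u v : EuclideanSpace ℝ (Fin m)} (hu : u ∈ ratioCone m)
    (hv : v ∈ ratioCone m) : WithLp.toLp 2 (fun i => min (u i) (v i)) ∈ ratioCone m := by
  intro k l h
  have := hu k l h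
  have := hv k l h
  dsimp only
  rcases le_total (u k) (v k) with hk | hk
  · rw [min_eq_left hk]; linarith [min_le_left (u l) (v l)]
  · rw [min_eq_right hk]; linarith [min_le_right (u l) (v l)]

theorem sup_mem_ratioCone {m : ℕ} {u v : EuclideanSpace ℝ (Fin m)} (hu : u ∈ ratioCone m)
    (hv : v ∈ ratioCone m) : WithLp.toLp 2 (fun i => max (u i) (v i)) ∈ ratioCone m := by
  intro k l h
  have := hu k l h
  have := hv k l h
  dsimp only
  exact max_le (by linarith [le_max_left (u k) (v k)]) (by linarith [le_max_right (u k) (v k)])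

theorem nonneg_of_mem_ratioCone {m : ℕ} (hm : 2 ≤ m) {x : EuclideanSpace ℝ (Fin m)}
    (hx : x ∈ ratioCone m) (i : Fin m) : 0 ≤ x i := by
  have : Nontrivial (Fin m) := Fin.nontrivial_iff_two_le.2 hm
  obtain ⟨j, hj⟩ := exists_ne i
  have := hx i j hj.symm
  have := hx j i hj
  linarith

theorem ones_mem_strictRatioSet {m : ℕ} (S : Set (Fin m × Fin m)) :
    (∑ i : Fin m, EuclideanSpace.single i (1 : ℝ)) ∈ strictRatioSet S := by
  intro p _
  simp [Finset.sum_apply, Pi.single_apply]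

theorem exists_sub_of_mem_ratioCone {m : ℕ} (z : EuclideanSpace ℝ (Fin m)) :
    ∃ x ∈ ratioCone m, ∃ y ∈ ratioCone m, z = x - y := by
  have he := ones_mem_strictRatioSet {p : Fin m × Fin m | p.1 ≠ p.2}
  obtain ⟨ε, hε, h⟩ := (isOpen_strictRatioSet _).exists_pos_add_smul_mem he z
  refine ⟨_, smul_mem_ratioCone (inv_nonneg.2 hε.le) (strictRatioSet_offDiag_subset h), _,
    smul_mem_ratioCone (inv_nonneg.2 hε.le) (strictRatioSet_offDiag_subset he), ?_⟩
  rw [← smul_sub, add_sub_cancel_left, inv_smul_smul₀ hε.ne']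

theorem setOf_inner_twoCoordVec_eq_ratioCone (m : ℕ) :
    {x : EuclideanSpace ℝ (Fin m) | ∀ k l : Fin m, k < l →
      ⟪twoCoordVec k l (-2) 1, x⟫ ≤ 0 ∧ ⟪twoCoordVec k l 1 (-2), x⟫ ≤ 0} = ratioCone m := by
  ext x
  simp only [Set.mem_ofPred_eq, inner_twoCoordVec, ratioCone]
  constructor
  · intro h k l hkl
    rcases lt_or_gt_of_ne hkl with h' | h'
    · linarith [(h k l h').1]
    · linarith [(h l k h').2]
  · intro h k l hkl
    constructor
    · linarith [h k l hkl.ne]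
    · linarith [h l k hkl.ne']

/-- For `m ≥ 2`, take for each `k < l` the vectors `a_{kl1}` (coordinate
`-2` in position `k`, `1` in position `l`, `0` elsewhere) and `a_{kl2}` (coordinate `1` in
position `k`, `-2` in position `l`, `0` elsewhere). Then
`K = ⋂_{k<l}(H_-(a_{kl1},0) ∩ H_-(a_{kl2},0))` is a generating convex cone contained in
`ℝ^m_+`, it is an `ℝ^m_+`-isotonic projection set, the vector `(1,…,1)` is an interior
point of `K`, and `K` possesses exactly `m(m-1)` facets. -/
theorem stmt_4 {m : ℕ} (hm : 2 ≤ m)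
    (K : Set (EuclideanSpace ℝ (Fin m)))
    (hK : K = {x | ∀ k l : Fin m, k < l →
      ⟪twoCoordVec k l (-2) 1, x⟫ ≤ 0 ∧ ⟪twoCoordVec k l 1 (-2), x⟫ ≤ 0}) :
    (∀ x ∈ K, ∀ y ∈ K, x + y ∈ K) ∧
    (∀ t : ℝ, 0 ≤ t → ∀ x ∈ K, t • x ∈ K) ∧
    (∀ z : EuclideanSpace ℝ (Fin m), ∃ x ∈ K, ∃ y ∈ K, z = x - y) ∧
    K ⊆ {x : EuclideanSpace ℝ (Fin m) | ∀ i, 0 ≤ x i} ∧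
    (∀ P : EuclideanSpace ℝ (Fin m) → EuclideanSpace ℝ (Fin m),
      (∀ x, P x ∈ K ∧ ∀ q ∈ K, dist x (P x) ≤ dist x q) →
      ∀ x y : EuclideanSpace ℝ (Fin m), (∀ i, x i ≤ y i) → ∀ i, P x i ≤ P y i) ∧
    (∑ i : Fin m, EuclideanSpace.single i (1 : ℝ)) ∈ interior K ∧
    {F | IsFacet K F}.Finite ∧ {F | IsFacet K F}.ncard = m * (m - 1) := by
  subst hK
  rw [setOf_inner_twoCoordVec_eq_ratioCone]
  refine ⟨fun x hx y hy => add_mem_ratioCone hx hy, fun t ht x hx => smul_mem_ratioCone ht hx,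
    exists_sub_of_mem_ratioCone, fun x hx => nonneg_of_mem_ratioCone hm hx,
    fun P hP x y hxy => ?_, ?_, ?_, ncard_isFacet_ratioCone m⟩
  · exact proj_isotone_of_lattice (convex_ratioCone m) (fun u hu v hv => inf_mem_ratioCone hu hv)
      (fun u hu v hv => sup_mem_ratioCone hu hv) (hP x).1 (hP y).1 (hP x).2 (hP y).2 hxy
  · exact interior_maximal strictRatioSet_offDiag_subset (isOpen_strictRatioSet _)
      (ones_mem_strictRatioSet _)
  · rw [setOf_isFacet_ratioCone]
    exact (Finset.finite_toSet _).image _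
end

section
/- Every isotonic regression cone K^w_E ⊆ ℝ^m is an ℝ^m_+-isotonic projection set; that is, for all u, v ∈ ℝ^m, if u ≤ v coordinate-wise then P_{K^w_E} u ≤ P_{K^w_E} v coordinate-wise. -/
/-- The coordinate-wise average of `x` and `x ⊓ y` inherits any scaled order relation between
coordinates satisfied by both `x` and `y`. -/
lemma add_min_half_div_le {a b x₁ x₂ y₁ y₂ : ℝ} (ha : 0 < a) (hb : 0 < b)
    (hx : x₁ / a ≤ x₂ / b) (hy : y₁ / a ≤ y₂ / b) :
    ((x₁ + min x₁ y₁) / 2) / a ≤ ((x₂ + min x₂ y₂) / 2) / b := by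
  have h : min x₁ y₁ / a ≤ min x₂ y₂ / b := by
    rw [← min_div_div_right ha.le, ← min_div_div_right hb.le]
    exact min_le_min hx hy
  rw [div_right_comm, div_right_comm _ 2 b, add_div _ _ a, add_div _ _ b]
  linarith

/-- The coordinate-wise average of `y` and `x ⊔ y` inherits any scaled order relation between
coordinates satisfied by both `x` and `y`. -/
lemma add_max_half_div_le {a b x₁ x₂ y₁ y₂ : ℝ} (ha : 0 < a) (hb : 0 < b)
    (hx : x₁ / a ≤ x₂ / b) (hy : y₁ / a ≤ y₂ / b) :
    ((y₁ + max x₁ y₁) / 2) / a ≤ ((y₂ + max x₂ y₂) / 2) / b := by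
  have h : max x₁ y₁ / a ≤ max x₂ y₂ / b := by
    rw [← max_div_div_right ha.le, ← max_div_div_right hb.le]
    exact max_le_max hx hy
  rw [div_right_comm, div_right_comm _ 2 b, add_div _ _ a, add_div _ _ b]
  linarith

/-- Every isotonic regression cone
`K^w_E = {x : x^i/√(w^i) ≤ x^j/√(w^j) for all (i,j) ∈ E}` is an `ℝ^m_+`-isotonic
projection set: if `u ≤ v` coordinate-wise then `P_{K^w_E} u ≤ P_{K^w_E} v`
coordinate-wise. -/
theorem stmt_5 {m : ℕ} (w : Fin m → ℝ) (hw : ∀ i, 0 < w i)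
    (E : Set (Fin m × Fin m)) (hloop : ∀ p ∈ E, p.1 ≠ p.2)
    (K : Set (EuclideanSpace ℝ (Fin m)))
    (hK : K = {x | ∀ p ∈ E, x p.1 / Real.sqrt (w p.1) ≤ x p.2 / Real.sqrt (w p.2)})
    (P : EuclideanSpace ℝ (Fin m) → EuclideanSpace ℝ (Fin m))
    (hP : ∀ x, P x ∈ K ∧ ∀ q ∈ K, dist x (P x) ≤ dist x q) :
    ∀ u v : EuclideanSpace ℝ (Fin m), (∀ i, u i ≤ v i) → ∀ i, P u i ≤ P v i := by
  have hsq : ∀ x, ∀ q ∈ K, ∑ i, (x i - P x i) ^ 2 ≤ ∑ i, (x i - q i) ^ 2 := by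
    intro x q hq
    have h := (hP x).2 q hq
    rw [EuclideanSpace.dist_eq, EuclideanSpace.dist_eq,
      Real.sqrt_le_sqrt_iff (Finset.sum_nonneg fun _ _ => sq_nonneg _)] at h
    simpa only [Real.dist_eq, sq_abs] using h
  intro u v huv
  have hp := (hP u).1
  have hq := (hP v).1
  have hu := hsq u (WithLp.toLp 2 fun i => (P u i + min (P u i) (P v i)) / 2) (by
    rw [hK] at hp hq ⊢
    exact fun e he => add_min_half_div_le (Real.sqrt_pos.2 (hw _)) (Real.sqrt_pos.2 (hw _))
      (hp e he) (hq e he))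
  have hv := hsq v (WithLp.toLp 2 fun i => (P v i + max (P u i) (P v i)) / 2) (by
    rw [hK] at hp hq ⊢
    exact fun e he => add_max_half_div_le (Real.sqrt_pos.2 (hw _)) (Real.sqrt_pos.2 (hw _))
      (hp e he) (hq e he))
  have hterm : ∀ i, (max (P u i - P v i) 0) ^ 2 / 2 ≤
      (u i - P u i) ^ 2 + (v i - P v i) ^ 2
        - ((u i - (P u i + min (P u i) (P v i)) / 2) ^ 2
          + (v i - (P v i + max (P u i) (P v i)) / 2) ^ 2) := by
    intro i
    rcases le_total (P u i) (P v i) with h | h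
    · rw [min_eq_left h, max_eq_right h, max_eq_right (sub_nonpos.2 h)]
      apply le_of_eq
      ring
    · rw [min_eq_right h, max_eq_left h, max_eq_left (sub_nonneg.2 h)]
      nlinarith [mul_nonneg (sub_nonneg.2 (huv i)) (sub_nonneg.2 h)]
  have hsum := Finset.sum_le_sum fun i (_ : i ∈ Finset.univ) => hterm i
  rw [Finset.sum_sub_distrib, Finset.sum_add_distrib, Finset.sum_add_distrib] at hsum
  intro i
  have hi : (max (P u i - P v i) 0) ^ 2 / 2 ≤ ∑ j, (max (P u j - P v j) 0) ^ 2 / 2 :=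
    Finset.single_le_sum (f := fun j => (max (P u j - P v j) 0) ^ 2 / 2)
      (fun _ _ => by positivity) (Finset.mem_univ i)
  have hzero : max (P u i - P v i) 0 = 0 :=
    pow_eq_zero_iff two_ne_zero |>.1 (le_antisymm (by linarith) (sq_nonneg _))
  exact sub_nonpos.1 (max_eq_right_iff.1 hzero)
end

section
/- Let K^w_E ⊆ ℝ^m be an isotonic regression cone which is closed and generating, and suppose the representation K^w_E = ∩_{(i,j)∈E} H_-(a_{ij}, 0), where a_{ij} has i-th coordinate 1/√(w^i), j-th coordinate −1/√(w^j) and all other coordinates 0, is irredundant. Then K^w_E is an isotonic projection cone (i.e., x ≤_{K^w_E} y implies P_{K^w_E} x ≤_{K^w_E} P_{K^w_E} y) if and only if the directed graph (V, E) contains no two distinct edges with the same tail and no two distinct edges with the same head; that is, there are no edges of the form (i,j) and (i,k) with j ≠ k, and no edges of the form (i,j) and (k,j) with i ≠ k. -/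
open scoped RealInnerProductSpace

/-- For an edge `p = (i, j)`, the normal vector `a_{ij} ∈ ℝ^m` with `i`-th coordinate
`1/√(w^i)`, `j`-th coordinate `-1/√(w^j)`, and all other coordinates `0`. -/
noncomputable def edgeNormal {m : ℕ} (w : Fin m → ℝ) (p : Fin m × Fin m) :
    EuclideanSpace ℝ (Fin m) :=
  (Real.sqrt (w p.1))⁻¹ • EuclideanSpace.single p.1 (1 : ℝ) -
    (Real.sqrt (w p.2))⁻¹ • EuclideanSpace.single p.2 (1 : ℝ)

section PolyhedralCone

variable {F ι : Type*} [NormedAddCommGroup F] [InnerProductSpace ℝ F]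

/-- The polyhedral cone with outer normals `a i`. -/
def polyhedralCone (a : ι → F) : Set F := {x | ∀ i, ⟪a i, x⟫ ≤ 0}

theorem convex_polyhedralCone (a : ι → F) : Convex ℝ (polyhedralCone a) := by
  intro x hx y hy s t hs ht _ i
  rw [inner_add_right, inner_smul_right, inner_smul_right]
  nlinarith [mul_nonneg hs (neg_nonneg.2 (hx i)), mul_nonneg ht (neg_nonneg.2 (hy i))]

/-- Variational characterization of nearest points. -/
theorem forall_dist_le_iff_inner_le_zero {K : Set F} (hK : Convex ℝ K) {x v : F} (hv : v ∈ K) :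
    (∀ q ∈ K, dist x v ≤ dist x q) ↔ ∀ q ∈ K, ⟪x - v, q - v⟫ ≤ 0 := by
  rw [← norm_eq_iInf_iff_real_inner_le_zero hK hv]
  have : Nonempty K := ⟨⟨v, hv⟩⟩
  have hbdd : BddBelow (Set.range fun w : K => ‖x - w‖) :=
    ⟨0, by rintro _ ⟨w, rfl⟩; exact norm_nonneg _⟩
  simp only [dist_eq_norm]
  refine ⟨fun h => le_antisymm (le_ciInf fun w => h w w.2) (ciInf_le hbdd ⟨v, hv⟩), fun h q hq => ?_⟩
  rw [h]
  exact ciInf_le hbdd ⟨q, hq⟩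

theorem eq_of_nearest {K : Set F} (hK : Convex ℝ K) {x u v : F} (hu : u ∈ K) (hv : v ∈ K)
    (h : ∀ q ∈ K, dist x u ≤ dist x q) (h' : ∀ q ∈ K, ⟪x - v, q - v⟫ ≤ 0) : u = v := by
  have h1 := (forall_dist_le_iff_inner_le_zero hK hu).1 h v hv
  have h2 := h' u hu
  have h3 : ⟪u - v, u - v⟫ = ⟪x - u, v - u⟫ + ⟪x - v, u - v⟫ := by
    rw [← neg_sub u v, inner_neg_right, neg_add_eq_sub, ← inner_sub_left]
    congr 1
    abel
  exact sub_eq_zero.1 (real_inner_self_nonpos.1 (by linarith))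

/-- A nonnegative linear relation between the normals of a generating cone is trivial. -/
theorem eq_zero_of_sum_smul_eq_zero [Fintype ι] {a : ι → F} (ha : ∀ i, a i ≠ 0)
    (hgen : ∀ z, ∃ x ∈ polyhedralCone a, ∃ y ∈ polyhedralCone a, z = x - y)
    {c : ι → ℝ} (hc : ∀ i, 0 ≤ c i) (h : ∑ i, c i • a i = 0) (i : ι) : c i = 0 := by
  have key : ∀ x ∈ polyhedralCone a, c i * ⟪a i, x⟫ = 0 := by
    intro x hx
    have h1 : ∑ j, c j * ⟪a j, x⟫ = 0 := by
      have := congrArg (fun v => ⟪v, x⟫) h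
      simpa [sum_inner, real_inner_smul_left] using this
    exact (Finset.sum_eq_zero_iff_of_nonpos
      fun j _ => mul_nonpos_of_nonneg_of_nonpos (hc j) (hx j)).1 h1 i (Finset.mem_univ i)
  obtain ⟨x, hx, y, hy, hxy⟩ := hgen (a i)
  have h2 : c i * ⟪a i, a i⟫ = 0 := by
    nth_rewrite 2 [hxy]
    rw [inner_sub_right, mul_sub, key x hx, key y hy, sub_zero]
  exact (mul_eq_zero.1 h2).resolve_right (inner_self_ne_zero.2 (ha i))

/-- For pairwise obtuse vectors, passing to positive parts does not increase the pairing. -/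
theorem norm_sum_posPart_smul_sq_le [Fintype ι] {a : ι → F}
    (hobt : ∀ i j, i ≠ j → ⟪a i, a j⟫ ≤ 0) (c : ι → ℝ) :
    ⟪∑ i, (c i)⁺ • a i, ∑ i, (c i)⁺ • a i⟫ ≤ ⟪∑ i, (c i)⁺ • a i, ∑ i, c i • a i⟫ := by
  simp only [sum_inner, inner_sum, real_inner_smul_left, real_inner_smul_right]
  refine Finset.sum_le_sum fun i _ => Finset.sum_le_sum fun j _ => ?_
  have hi := le_posPart (c i)
  have hj := posPart_nonneg (c j)
  by_cases hij : i = j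
  · subst hij
    rcases le_total 0 (c i) with h | h
    · rw [posPart_of_nonneg h]
    · simp [posPart_of_nonpos h]
  · nlinarith [mul_nonneg (mul_nonneg hj (sub_nonneg.2 hi))
      (neg_nonneg.2 (hobt j i (Ne.symm hij)))]

theorem linearIndependent_of_obtuse [Fintype ι] {a : ι → F} (ha : ∀ i, a i ≠ 0)
    (hgen : ∀ z, ∃ x ∈ polyhedralCone a, ∃ y ∈ polyhedralCone a, z = x - y)
    (hobt : ∀ i j, i ≠ j → ⟪a i, a j⟫ ≤ 0) : LinearIndependent ℝ a := by
  have key : ∀ c : ι → ℝ, ∑ i, c i • a i = 0 → ∀ i, c i ≤ 0 := by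
    intro c hc i
    have h := norm_sum_posPart_smul_sq_le hobt c
    rw [hc, inner_zero_right] at h
    exact posPart_eq_zero.1 (eq_zero_of_sum_smul_eq_zero ha hgen (fun i => posPart_nonneg (c i))
      (real_inner_self_nonpos.1 h) i)
  rw [Fintype.linearIndependent_iff]
  intro c hc i
  refine le_antisymm (key c hc i) ?_
  have := key (-c) (by simpa using hc) i
  simpa using this

/-- Farkas' lemma for linearly independent normals. -/
theorem exists_nonneg_sum_smul_eq [Fintype ι] {a : ι → F} (ha : LinearIndependent ℝ a) {v : F}
    (hv : ∀ x ∈ polyhedralCone a, ⟪v, x⟫ ≤ 0) :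
    ∃ c : ι → ℝ, (∀ i, 0 ≤ c i) ∧ ∑ i, c i • a i = v := by
  have hmem : v ∈ Submodule.span ℝ (Set.range a) := by
    have : FiniteDimensional ℝ (Submodule.span ℝ (Set.range a)) :=
      FiniteDimensional.span_of_finite ℝ (Set.finite_range a)
    let S := Submodule.span ℝ (Set.range a)
    have horth : ∀ u ∈ S, ⟪u, v - S.starProjection v⟫ = 0 := fun u hu =>
      (Submodule.mem_orthogonal _ _).1 (S.sub_starProjection_mem_orthogonal v) u hu
    have h1 := hv (v - S.starProjection v)
      fun i => (horth _ (Submodule.subset_span ⟨i, rfl⟩)).le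
    have h2 : ⟪v - S.starProjection v, v - S.starProjection v⟫ ≤ 0 := by
      rw [inner_sub_left, horth _ (S.starProjection_apply_mem v), sub_zero]
      exact h1
    rw [sub_eq_zero.1 (real_inner_self_nonpos.1 h2)]
    exact S.starProjection_apply_mem v
  obtain ⟨c, hc⟩ := (Submodule.mem_span_range_iff_exists_fun ℝ).1 hmem
  refine ⟨c, fun i => ?_, hc⟩
  let S := Submodule.span ℝ (a '' {j | j ≠ i})
  have : FiniteDimensional ℝ S := FiniteDimensional.span_of_finite ℝ (Set.toFinite _)
  let z := a i - S.starProjection (a i)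
  have horth : ∀ u ∈ S, ⟪u, z⟫ = 0 := fun u hu =>
    (Submodule.mem_orthogonal _ _).1 (S.sub_starProjection_mem_orthogonal (a i)) u hu
  have hother : ∀ j, j ≠ i → ⟪a j, z⟫ = 0 := fun j hj =>
    horth _ (Submodule.subset_span ⟨j, hj, rfl⟩)
  have hself : ⟪a i, z⟫ = ⟪z, z⟫ := by
    have h1 : ⟪z, z⟫ = ⟪a i, z⟫ - ⟪S.starProjection (a i), z⟫ := inner_sub_left _ _ _
    rw [h1, horth _ (S.starProjection_apply_mem _), sub_zero]
  have hz : z ≠ 0 := by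
    intro h
    have h1 : a i ∈ S := by
      rw [sub_eq_zero.1 h]
      exact S.starProjection_apply_mem _
    exact ha.notMem_span_image (s := {j | j ≠ i}) (x := i) (by simp) h1
  have hpos : 0 < ⟪z, z⟫ := real_inner_self_pos.2 hz
  have h1 := hv (-z) fun j => by
    rw [inner_neg_right]
    by_cases hj : j = i
    · rw [hj, hself]; linarith
    · rw [hother j hj, neg_zero]
  have h2 : ⟪v, z⟫ = c i * ⟪z, z⟫ := by
    rw [← hc, sum_inner, Finset.sum_eq_single i]
    · rw [real_inner_smul_left, hself]
    · intro j _ hj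
      rw [real_inner_smul_left, hother j hj, mul_zero]
    · simp
  rw [inner_neg_right, h2] at h1
  exact nonneg_of_mul_nonneg_left (by linarith) hpos

/-- Karush–Kuhn–Tucker conditions for the projection onto a cone with linearly independent
normals. -/
theorem exists_multipliers_of_nearest [Fintype ι] {a : ι → F} (ha : LinearIndependent ℝ a)
    {x u : F} (hu : u ∈ polyhedralCone a) (h : ∀ q ∈ polyhedralCone a, dist x u ≤ dist x q) :
    ∃ c : ι → ℝ, (∀ i, 0 ≤ c i) ∧ x = u + ∑ i, c i • a i ∧ ∀ i, c i * ⟪a i, u⟫ = 0 := by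
  have hvar := (forall_dist_le_iff_inner_le_zero (convex_polyhedralCone a) hu).1 h
  have hpolar : ∀ y ∈ polyhedralCone a, ⟪x - u, y⟫ ≤ 0 := by
    intro y hy
    have := hvar (u + y) fun i => by
      rw [inner_add_right]
      linarith [hu i, hy i]
    simpa using this
  obtain ⟨c, hc, hsum⟩ := exists_nonneg_sum_smul_eq ha hpolar
  refine ⟨c, hc, by rw [hsum]; abel, fun i => ?_⟩
  have h0 : 0 ≤ ⟪x - u, u⟫ := by
    have := hvar 0 fun i => by rw [inner_zero_right]
    rw [zero_sub, inner_neg_right] at this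
    linarith
  have h1 : ∑ j, c j * ⟪a j, u⟫ = 0 := by
    have h2 : ∑ j, c j * ⟪a j, u⟫ = ⟪x - u, u⟫ := by
      simp [← hsum, sum_inner, real_inner_smul_left]
    rw [h2]
    exact le_antisymm (hpolar u hu) h0
  exact (Finset.sum_eq_zero_iff_of_nonpos
    fun j _ => mul_nonpos_of_nonneg_of_nonpos (hc j) (hu j)).1 h1 i (Finset.mem_univ i)

/-- A generating polyhedral cone with pairwise obtuse normals is an isotonic projection cone. -/
theorem isotone_projection_of_obtuse [Fintype ι] {a : ι → F} (ha : ∀ i, a i ≠ 0)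
    (hgen : ∀ z, ∃ x ∈ polyhedralCone a, ∃ y ∈ polyhedralCone a, z = x - y)
    (hobt : ∀ i j, i ≠ j → ⟪a i, a j⟫ ≤ 0) {P : F → F}
    (hP : ∀ x, P x ∈ polyhedralCone a ∧ ∀ q ∈ polyhedralCone a, dist x (P x) ≤ dist x q)
    {x y : F} (hxy : y - x ∈ polyhedralCone a) : P y - P x ∈ polyhedralCone a := by
  have hli := linearIndependent_of_obtuse ha hgen hobt
  obtain ⟨c, hc, hx, hcx⟩ := exists_multipliers_of_nearest hli (hP x).1 (hP x).2
  obtain ⟨d, hd, hy, hdy⟩ := exists_multipliers_of_nearest hli (hP y).1 (hP y).2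
  have hdiff : y - x = (P y - P x) + ∑ i, (d i - c i) • a i := by
    simp only [sub_smul, Finset.sum_sub_distrib]
    nth_rewrite 1 [hx, hy]
    abel
  have hpair : ∀ i, ⟪a i, P y - P x⟫ + ⟪a i, ∑ j, (d j - c j) • a j⟫ ≤ 0 := by
    intro i
    rw [← inner_add_right, ← hdiff]
    exact hxy i
  have hle : ∀ i, d i ≤ c i := by
    intro i
    have h1 := norm_sum_posPart_smul_sq_le hobt fun i => d i - c i
    have h2 : ⟪∑ i, (d i - c i)⁺ • a i, ∑ i, (d i - c i) • a i⟫ ≤ 0 := by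
      rw [sum_inner]
      refine Finset.sum_nonpos fun j _ => ?_
      rw [real_inner_smul_left]
      rcases le_or_gt (d j) (c j) with h | h
      · rw [posPart_of_nonpos (sub_nonpos.2 h), zero_mul]
      · refine mul_nonpos_of_nonneg_of_nonpos (posPart_nonneg _) ?_
        have h3 : ⟪a j, P y⟫ = 0 :=
          (mul_eq_zero.1 (hdy j)).resolve_left ((hc j).trans_lt h).ne'
        have h4 := hpair j
        rw [inner_sub_right, h3] at h4
        linarith [(hP x).1 j]
    have h3 := eq_zero_of_sum_smul_eq_zero ha hgen (fun i => posPart_nonneg (d i - c i))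
      (real_inner_self_nonpos.1 (h1.trans h2)) i
    exact sub_nonpos.1 (posPart_eq_zero.1 h3)
  intro i
  rcases (mul_eq_zero.1 (hcx i)) with h | h
  · have hdi : d i = 0 := le_antisymm (h ▸ hle i) (hd i)
    have h1 : 0 ≤ ⟪a i, ∑ j, (d j - c j) • a j⟫ := by
      rw [inner_sum]
      refine Finset.sum_nonneg fun j _ => ?_
      rw [real_inner_smul_right]
      by_cases hij : i = j
      · subst hij
        rw [h, hdi, sub_zero, zero_mul]
      · exact mul_nonneg_of_nonpos_of_nonpos (sub_nonpos.2 (hle j)) (hobt i j hij)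
    linarith [hpair i]
  · rw [inner_sub_right, h, sub_zero]
    exact (hP y).1 i

/-- A generating polyhedral cone with nonzero normals has an interior point. -/
theorem exists_forall_inner_neg [Fintype ι] {a : ι → F} (ha : ∀ i, a i ≠ 0)
    (hgen : ∀ z, ∃ x ∈ polyhedralCone a, ∃ y ∈ polyhedralCone a, z = x - y) :
    ∃ z, ∀ i, ⟪a i, z⟫ < 0 := by
  have h : ∀ i, ∃ x ∈ polyhedralCone a, ⟪a i, x⟫ < 0 := by
    intro i
    obtain ⟨x, hx, y, hy, hxy⟩ := hgen (a i)
    have h1 : 0 < ⟪a i, x⟫ - ⟪a i, y⟫ := by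
      rw [← inner_sub_right, ← hxy]
      exact real_inner_self_pos.2 (ha i)
    exact ⟨y, hy, by linarith [hx i]⟩
  choose x hx hneg using h
  refine ⟨∑ j, x j, fun i => ?_⟩
  rw [inner_sum]
  exact Finset.sum_neg' (fun j _ => hx j i) ⟨i, Finset.mem_univ i, hneg i⟩

/-- The facet of an irredundant normal contains a point at which no other constraint is active. -/
theorem exists_mem_facet [Fintype ι] {a : ι → F} (ha : ∀ i, a i ≠ 0)
    (hgen : ∀ z, ∃ x ∈ polyhedralCone a, ∃ y ∈ polyhedralCone a, z = x - y) {i : ι}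
    (hirr : ∃ z, 0 < ⟪a i, z⟫ ∧ ∀ j, j ≠ i → ⟪a j, z⟫ ≤ 0) :
    ∃ z, ⟪a i, z⟫ = 0 ∧ ∀ j, j ≠ i → ⟪a j, z⟫ < 0 := by
  obtain ⟨u, hu⟩ := exists_forall_inner_neg ha hgen
  obtain ⟨z, hz, hzj⟩ := hirr
  refine ⟨⟪a i, z⟫ • u - ⟪a i, u⟫ • z, ?_, fun j hj => ?_⟩
  · rw [inner_sub_right, real_inner_smul_right, real_inner_smul_right]
    ring
  · rw [inner_sub_right, real_inner_smul_right, real_inner_smul_right]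
    nlinarith [mul_pos hz (neg_pos.2 (hu j)),
      mul_nonneg (neg_nonneg.2 (hu i).le) (neg_nonneg.2 (hzj j hj))]

/-- The normals of an irredundantly represented generating isotonic projection cone are pairwise
obtuse. -/
theorem obtuse_of_isotone_projection [Fintype ι] {a : ι → F} (ha : ∀ i, a i ≠ 0)
    (hgen : ∀ z, ∃ x ∈ polyhedralCone a, ∃ y ∈ polyhedralCone a, z = x - y)
    (hirr : ∀ i, ∃ z, 0 < ⟪a i, z⟫ ∧ ∀ j, j ≠ i → ⟪a j, z⟫ ≤ 0) {P : F → F}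
    (hP : ∀ x, P x ∈ polyhedralCone a ∧ ∀ q ∈ polyhedralCone a, dist x (P x) ≤ dist x q)
    (hiso : ∀ x y, y - x ∈ polyhedralCone a → P y - P x ∈ polyhedralCone a)
    {i j : ι} (hij : i ≠ j) : ⟪a i, a j⟫ ≤ 0 := by
  obtain ⟨u, hui, hu⟩ := exists_mem_facet ha hgen (hirr i)
  obtain ⟨v, hvj, hv⟩ := exists_mem_facet ha hgen (hirr j)
  have huK : u ∈ polyhedralCone a := fun k => by
    by_cases hk : k = i
    · rw [hk, hui]
    · exact (hu k hk).le
  have hvK : v ∈ polyhedralCone a := fun k => by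
    by_cases hk : k = j
    · rw [hk, hvj]
    · exact (hv k hk).le
  have hpos : 0 < ⟪a i, a i⟫ := real_inner_self_pos.2 (ha i)
  set t := -(⟪a i, v⟫ / ⟪a i, a i⟫) with ht
  have htpos : 0 < t := neg_pos.2 (div_neg_of_neg_of_pos (hv i hij) hpos)
  have hti : ⟪a i, v + t • a i⟫ = 0 := by
    rw [inner_add_right, real_inner_smul_right, ht]
    field_simp
    ring
  obtain ⟨ε, hε, hsmall⟩ : ∃ ε : ℝ, 0 < ε ∧ u + ε • (v + t • a i) ∈ polyhedralCone a := by
    have h1 : ∀ k, ∀ᶠ ε in nhdsWithin (0 : ℝ) (Set.Ioi 0),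
        ⟪a k, u + ε • (v + t • a i)⟫ ≤ 0 := by
      intro k
      by_cases hk : k = i
      · subst hk
        refine Filter.Eventually.of_forall fun ε => ?_
        rw [inner_add_right, real_inner_smul_right, hti, hui, mul_zero, add_zero]
      · have hcont : Continuous fun ε : ℝ => ⟪a k, u + ε • (v + t • a i)⟫ := by fun_prop
        have h2 : ∀ᶠ ε in nhds (0 : ℝ), ⟪a k, u + ε • (v + t • a i)⟫ < 0 :=
          hcont.continuousAt.eventually_lt continuousAt_const (by simpa using hu k hk)
        exact (h2.filter_mono nhdsWithin_le_nhds).mono fun _ h => h.le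
    obtain ⟨ε, h2, h3⟩ := ((Filter.eventually_all.2 h1).and self_mem_nhdsWithin).exists
    exact ⟨ε, h3, h2⟩
  have hPx : P (u + (ε * t) • a i) = u := by
    refine eq_of_nearest (convex_polyhedralCone a) (hP _).1 huK (hP _).2 fun q hq => ?_
    rw [add_sub_cancel_left, real_inner_smul_left, inner_sub_right, hui, sub_zero]
    exact mul_nonpos_of_nonneg_of_nonpos (mul_pos hε htpos).le (hq i)
  have hPy : P (u + ε • (v + t • a i)) = u + ε • (v + t • a i) :=
    eq_of_nearest (convex_polyhedralCone a) (hP _).1 hsmall (hP _).2 fun q _ => by simp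
  have hmem := hiso (u + (ε * t) • a i) (u + ε • (v + t • a i)) fun k => by
    have h1 : u + ε • (v + t • a i) - (u + (ε * t) • a i) = ε • v := by
      rw [smul_add, smul_smul]
      abel
    rw [h1, real_inner_smul_right]
    exact mul_nonpos_of_nonneg_of_nonpos hε.le (hvK k)
  have h1 := hmem j
  rw [hPx, hPy, add_sub_cancel_left, real_inner_smul_right, inner_add_right, hvj, zero_add,
    real_inner_smul_right, ← mul_assoc] at h1
  rw [real_inner_comm]
  exact nonpos_of_mul_nonpos_right h1 (mul_pos hε htpos)

end PolyhedralCone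

theorem inner_edgeNormal {m : ℕ} (w : Fin m → ℝ) (p q : Fin m × Fin m) :
    ⟪edgeNormal w p, edgeNormal w q⟫ =
      (if p.1 = q.1 then (√(w p.1))⁻¹ * (√(w q.1))⁻¹ else 0) -
      (if p.1 = q.2 then (√(w p.1))⁻¹ * (√(w q.2))⁻¹ else 0) -
      (if p.2 = q.1 then (√(w p.2))⁻¹ * (√(w q.1))⁻¹ else 0) +
      (if p.2 = q.2 then (√(w p.2))⁻¹ * (√(w q.2))⁻¹ else 0) := by
  simp only [edgeNormal, inner_sub_left, inner_sub_right, real_inner_smul_left,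
    real_inner_smul_right, EuclideanSpace.inner_single_left, PiLp.single_apply]
  simp only [map_one, mul_ite, mul_one, mul_zero]
  simp only [mul_comm (√(w q.1))⁻¹, mul_comm (√(w q.2))⁻¹]
  ring

theorem edgeNormal_ne_zero {m : ℕ} {w : Fin m → ℝ} (hw : ∀ i, 0 < w i) {p : Fin m × Fin m}
    (hp : p.1 ≠ p.2) : edgeNormal w p ≠ 0 := by
  intro h
  have h1 := inner_edgeNormal w p p
  rw [h, inner_zero_left, if_pos rfl, if_neg hp, if_neg hp.symm, if_pos rfl] at h1
  have hpos : ∀ i, 0 < (√(w i))⁻¹ := fun i => inv_pos.2 (Real.sqrt_pos.2 (hw i))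
  nlinarith [mul_pos (hpos p.1) (hpos p.1), mul_pos (hpos p.2) (hpos p.2)]

/-- Two edges have obtuse normals if and only if they share neither tail nor head. -/
theorem inner_edgeNormal_nonpos_iff {m : ℕ} {w : Fin m → ℝ} (hw : ∀ i, 0 < w i)
    {p q : Fin m × Fin m} (hp : p.1 ≠ p.2) (hq : q.1 ≠ q.2) :
    ⟪edgeNormal w p, edgeNormal w q⟫ ≤ 0 ↔ p.1 ≠ q.1 ∧ p.2 ≠ q.2 := by
  have hpos : ∀ i j, 0 < (√(w i))⁻¹ * (√(w j))⁻¹ := fun i j =>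
    mul_pos (inv_pos.2 (Real.sqrt_pos.2 (hw i))) (inv_pos.2 (Real.sqrt_pos.2 (hw j)))
  rw [inner_edgeNormal]
  constructor
  · intro h
    constructor
    · intro h1
      rw [if_pos h1, if_neg (h1 ▸ hq), if_neg (h1 ▸ hp.symm)] at h
      split_ifs at h <;> linarith [hpos p.1 q.1, hpos p.2 q.2]
    · intro h2
      have h3 : p.1 ≠ q.2 := h2 ▸ hp
      have h4 : p.2 ≠ q.1 := h2 ▸ hq.symm
      rw [if_pos h2, if_neg h3, if_neg h4] at h
      split_ifs at h <;> linarith [hpos p.1 q.1, hpos p.2 q.2]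
  · rintro ⟨h1, h2⟩
    rw [if_neg h1, if_neg h2]
    split_ifs <;> linarith [hpos p.1 q.2, hpos p.2 q.1]

/-- Let `K^w_E` be a closed, generating isotonic regression cone whose
representation `K^w_E = ⋂_{(i,j)∈E} H_-(a_{ij},0)` is irredundant. Then `K^w_E` is an
isotonic projection cone if and only if the directed graph `(V, E)` has no two distinct
edges with the same tail and no two distinct edges with the same head. -/
theorem stmt_6 {m : ℕ} (w : Fin m → ℝ) (hw : ∀ i, 0 < w i)
    (E : Set (Fin m × Fin m)) (hloop : ∀ p ∈ E, p.1 ≠ p.2)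
    (K : Set (EuclideanSpace ℝ (Fin m)))
    (hK : K = {x | ∀ p ∈ E, x p.1 / Real.sqrt (w p.1) ≤ x p.2 / Real.sqrt (w p.2)})
    (hclosed : IsClosed K)
    (hgen : ∀ z : EuclideanSpace ℝ (Fin m), ∃ x ∈ K, ∃ y ∈ K, z = x - y)
    (hRep : K = ⋂ p ∈ E, {x | ⟪edgeNormal w p, x⟫ ≤ 0})
    (hirr : ∀ p ∈ E,
      ¬ ((⋂ q ∈ E \ {p}, {x : EuclideanSpace ℝ (Fin m) | ⟪edgeNormal w q, x⟫ ≤ 0}) ⊆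
        {x : EuclideanSpace ℝ (Fin m) | ⟪edgeNormal w p, x⟫ ≤ 0}))
    (P : EuclideanSpace ℝ (Fin m) → EuclideanSpace ℝ (Fin m))
    (hP : ∀ x, P x ∈ K ∧ ∀ q ∈ K, dist x (P x) ≤ dist x q) :
    (∀ x y : EuclideanSpace ℝ (Fin m), y - x ∈ K → P y - P x ∈ K) ↔
      ((∀ i j k : Fin m, (i, j) ∈ E → (i, k) ∈ E → j = k) ∧
       (∀ i j k : Fin m, (i, j) ∈ E → (k, j) ∈ E → i = k)) := by
  have : Fintype E := Fintype.ofFinite E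
  let a : E → EuclideanSpace ℝ (Fin m) := fun p => edgeNormal w p
  have hKa : K = polyhedralCone a := by
    rw [hRep]
    ext x
    simp [polyhedralCone, a]
  have ha : ∀ p, a p ≠ 0 := fun p => edgeNormal_ne_zero hw (hloop p p.2)
  have hirr' : ∀ p, ∃ z, 0 < ⟪a p, z⟫ ∧ ∀ q, q ≠ p → ⟪a q, z⟫ ≤ 0 := by
    rintro ⟨p, hp⟩
    obtain ⟨z, hz, hzp⟩ := Set.not_subset.1 (hirr p hp)
    refine ⟨z, not_le.1 hzp, fun q hq => ?_⟩
    exact Set.mem_iInter₂.1 hz q ⟨q.2, fun h => hq (Subtype.ext h)⟩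
  have hgraph : ((∀ i j k : Fin m, (i, j) ∈ E → (i, k) ∈ E → j = k) ∧
      (∀ i j k : Fin m, (i, j) ∈ E → (k, j) ∈ E → i = k)) ↔
      ∀ p q : E, p ≠ q → ⟪a p, a q⟫ ≤ 0 := by
    have hiff : ∀ p q : E, ⟪a p, a q⟫ ≤ 0 ↔ p.1.1 ≠ q.1.1 ∧ p.1.2 ≠ q.1.2 := fun p q =>
      inner_edgeNormal_nonpos_iff hw (hloop p p.2) (hloop q q.2)
    constructor
    · rintro ⟨htail, hhead⟩ ⟨⟨i, j⟩, hp⟩ ⟨⟨k, l⟩, hq⟩ hpq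
      rw [hiff]
      refine ⟨?_, ?_⟩
      · rintro rfl
        obtain rfl := htail _ _ _ hp hq
        exact hpq rfl
      · rintro rfl
        obtain rfl := hhead _ _ _ hp hq
        exact hpq rfl
    · intro h
      refine ⟨fun i j k hp hq => ?_, fun i j k hp hq => ?_⟩
      · by_contra hjk
        have hne : (⟨(i, j), hp⟩ : E) ≠ ⟨(i, k), hq⟩ := by simpa using hjk
        exact ((hiff _ _).1 (h _ _ hne)).1 rfl
      · by_contra hik
        have hne : (⟨(i, j), hp⟩ : E) ≠ ⟨(k, j), hq⟩ := by simpa using hik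
        exact ((hiff _ _).1 (h _ _ hne)).2 rfl
  rw [hKa] at hgen hP
  rw [hgraph, hKa]
  exact ⟨fun hiso p q hpq => obtuse_of_isotone_projection ha hgen hirr' hP hiso hpq,
    fun hobt x y => isotone_projection_of_obtuse ha hgen hobt hP⟩
end

section
/- For any weights w^1, …, w^m > 0, the weighted monotone cone K = {x ∈ ℝ^m : x^1/√(w^1) ≤ x^2/√(w^2) ≤ ⋯ ≤ x^m/√(w^m)} is an isotonic projection cone; that is, for all x, y ∈ ℝ^m, x ≤_K y implies P_K x ≤_K P_K y. -/
/-- One half of the optimality argument: at a covering pair where `v - u` drops, moving `u` up and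
`v` down below the pair would improve the fit unless `v - u ≤ c` at the lower point. -/
lemma sub_le_of_covBy_of_optimal {ι : Type*} [LinearOrder ι] [Fintype ι] {W c u v : ι → ℝ}
    (hW : ∀ i, 0 < W i) (hc : Monotone c) (hu : Monotone u) (hv : Monotone v)
    (hopt : ∀ h : ι → ℝ, Monotone (u + h) → Monotone (v - h) →
      ∑ i, W i * ((v i - u i - c i - h i) * h i) ≤ 0)
    {k l : ι} (hkl : k ⋖ l) (hd : v l - u l < v k - u k) : v k - u k ≤ c k := by
  by_contra! hck
  obtain ⟨τ, hτ, hτk⟩ := exists_between (max_lt hck hd)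
  obtain ⟨hcτ, hlτ⟩ := max_lt_iff.1 hτ
  set h : ι → ℝ := fun i => if i ≤ k then max (v i - u i - τ) 0 else 0 with h_def
  have above {j : ι} (hj : ¬ j ≤ k) : l ≤ j := hkl.ge_of_gt (not_le.1 hj)
  refine (hopt h ?_ ?_).not_gt (Finset.sum_pos' (fun i _ => ?_) ⟨k, Finset.mem_univ k, ?_⟩)
  · intro i j hij
    have hu_ij := hu hij
    have hv_ij := hv hij
    by_cases hj : j ≤ k
    · simp only [h_def, Pi.add_apply, if_pos hj, if_pos (hij.trans hj)]
      grind
    by_cases hi : i ≤ k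
    · have := hu (above hj)
      have := hv (hi.trans hkl.le)
      simp only [h_def, Pi.add_apply, if_neg hj, if_pos hi]
      grind
    · simpa [h_def, hi, hj] using hu_ij
  · intro i j hij
    have hu_ij := hu hij
    have hv_ij := hv hij
    by_cases hj : j ≤ k
    · simp only [h_def, Pi.sub_apply, if_pos hj, if_pos (hij.trans hj)]
      grind
    by_cases hi : i ≤ k
    · simp only [h_def, Pi.sub_apply, if_neg hj, if_pos hi]
      grind
    · simpa [h_def, hi, hj] using hv_ij
  · by_cases hi : i ≤ k
    · have := hc hi
      simp only [h_def, if_pos hi]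
      rcases le_total (v i - u i - τ) 0 with h0 | h0
      · simp [max_eq_right h0]
      · rw [max_eq_left h0]
        exact mul_nonneg (hW i).le (mul_nonneg (by linarith) h0)
    · simp [h_def, hi]
  · simp only [h_def, if_pos le_rfl]
    rw [max_eq_left (by linarith)]
    exact mul_pos (hW k) (mul_pos (by linarith) (by linarith))

lemma monotone_sub_of_optimal {ι : Type*} [LinearOrder ι] [Fintype ι] {W c u v : ι → ℝ}
    (hW : ∀ i, 0 < W i) (hc : Monotone c) (hu : Monotone u) (hv : Monotone v)
    (hopt : ∀ h : ι → ℝ, Monotone (u + h) → Monotone (v - h) →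
      ∑ i, W i * ((v i - u i - c i - h i) * h i) ≤ 0) : Monotone (v - u) := by
  let _ : LocallyFiniteOrder ι := Fintype.toLocallyFiniteOrder
  rw [monotone_iff_forall_covBy]
  intro k l hkl
  by_contra! hd
  simp only [Pi.sub_apply] at hd
  have hk := sub_le_of_covBy_of_optimal hW hc hu hv hopt hkl hd
  have hl := sub_le_of_covBy_of_optimal (ι := ιᵒᵈ) (W := fun i => W i.ofDual)
    (c := fun i => -c i.ofDual) (u := fun i => -u i.ofDual) (v := fun i => -v i.ofDual)
    (fun i => hW i.ofDual) (fun i j hij => neg_le_neg (hc hij))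
    (fun i j hij => neg_le_neg (hu hij)) (fun i j hij => neg_le_neg (hv hij))
    (fun h hu' hv' => ?_) (k := OrderDual.toDual l) (l := OrderDual.toDual k)
    hkl.toDual (by simp only [OrderDual.ofDual_toDual]; linarith)
  · simp only [OrderDual.ofDual_toDual] at hl
    have := hc hkl.le
    linarith
  · have key := hopt (fun i => -h (OrderDual.toDual i))
      (fun i j hij => by
        have := hu' (OrderDual.toDual_le_toDual.2 hij)
        simp only [Pi.add_apply, OrderDual.ofDual_toDual] at this ⊢
        linarith)
      (fun i j hij => by
        have := hv' (OrderDual.toDual_le_toDual.2 hij)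
        simp only [Pi.sub_apply, OrderDual.ofDual_toDual] at this ⊢
        linarith)
    refine le_of_eq_of_le ?_ key
    refine Fintype.sum_equiv OrderDual.ofDual _ _ fun i => ?_
    simp only [OrderDual.toDual_ofDual]
    ring

/-- For any weights `w^1, …, w^m > 0`, the weighted monotone cone
`K = {x : x^1/√(w^1) ≤ x^2/√(w^2) ≤ ⋯ ≤ x^m/√(w^m)}` is an isotonic projection cone:
`x ≤_K y` implies `P_K x ≤_K P_K y`. -/
theorem stmt_8 {m : ℕ} (w : Fin m → ℝ) (hw : ∀ i, 0 < w i)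
    (K : Set (EuclideanSpace ℝ (Fin m)))
    (hK : K = {x | Monotone fun i => x i / Real.sqrt (w i)})
    (P : EuclideanSpace ℝ (Fin m) → EuclideanSpace ℝ (Fin m))
    (hP : ∀ x, P x ∈ K ∧ ∀ q ∈ K, dist x (P x) ≤ dist x q) :
    ∀ x y : EuclideanSpace ℝ (Fin m), y - x ∈ K → P y - P x ∈ K := by
  subst hK
  intro x y hxy
  have hs (i : Fin m) : 0 < √(w i) := Real.sqrt_pos.2 (hw i)
  have hfit (z : EuclideanSpace ℝ (Fin m)) (g : Fin m → ℝ)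
      (hg : Monotone fun i => P z i / √(w i) + g i) :
      ∑ i, (z i - P z i) ^ 2 ≤ ∑ i, (z i - (P z i + √(w i) * g i)) ^ 2 := by
    have hq := (hP z).2 (WithLp.toLp 2 fun i => P z i + √(w i) * g i) (by
      simpa [add_div, (hs _).ne'] using hg)
    rw [EuclideanSpace.dist_eq, EuclideanSpace.dist_eq,
      Real.sqrt_le_sqrt_iff (Finset.sum_nonneg fun i _ => sq_nonneg _)] at hq
    simpa only [Real.dist_eq, sq_abs] using hq
  have hmono := monotone_sub_of_optimal (W := w) (c := fun i => (y - x) i / √(w i))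
    (u := fun i => P x i / √(w i)) (v := fun i => P y i / √(w i)) hw hxy (hP x).1 (hP y).1 ?_
  · simpa [Pi.sub_def, sub_div] using hmono
  · intro h hu hv
    have h₁ := hfit x h hu
    have h₂ := hfit y (-h) (by rwa [sub_eq_add_neg] at hv)
    have hsum := add_le_add h₁ h₂
    rw [← sub_nonpos, ← Finset.sum_add_distrib, ← Finset.sum_add_distrib,
      ← Finset.sum_sub_distrib] at hsum
    suffices ∑ i, 2 * (w i * ((P y i / √(w i) - P x i / √(w i) - (y - x) i / √(w i) - h i) * h i))
        ≤ 0 by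
      rw [← Finset.mul_sum] at this
      linarith
    refine le_of_eq_of_le (Finset.sum_congr rfl fun i _ => ?_) hsum
    have hsq : w i = √(w i) ^ 2 := (Real.sq_sqrt (hw i).le).symm
    have hne := (hs i).ne'
    rw [PiLp.sub_apply, Pi.neg_apply]
    generalize √(w i) = s at *
    rw [hsq]
    field_simp
    ring
end
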